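/- arXiv:2307.06787 — 8 statements merged into one kernel-verified Lean document; each statement's English description precedes it below -/
import Mathlib

section
/- Let D be a nonempty set, let F be a convex and symmetric (f ∈ F implies −f ∈ F) class of functions f : D → ℝ, and let S be a real linear functional defined on the linear span of F. An adaptive deterministic algorithm using n function values is given by a point x₁ ∈ D, maps ψ_j : ℝ^j → D (j = 1,…,n−1) determining x_{j+1} = ψ_j(f(x₁),…,f(x_j)), and an arbitrary map φ : ℝⁿ → ℝ, with output A(f) = φ(f(x₁),…,f(xₙ)). Then, as elements of [0,∞], the minimal worst-case error over all such adaptive algorithms satisfies inf_A sup_{f ∈ F} |S(f) − A(f)| = inf_{x₁,…,xₙ ∈ D} sup{ S(f) : f ∈ F, f(x₁) = ⋯ = f(xₙ) = 0 }. -/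
/-- The sequence of sample points produced by an adaptive algorithm: the `j`-th point is
chosen by the map `x j` applied to the previously computed function values. -/
noncomputable def adaptPts {D : Type*} {n : ℕ}
    (x : (j : Fin n) → (Fin (j : ℕ) → ℝ) → D) (f : D → ℝ) : Fin n → D
  | j => x j fun i => f (adaptPts x f ⟨(i : ℕ), i.isLt.trans j.isLt⟩)
  termination_by j => (j : ℕ)
  decreasing_by exact i.isLt

theorem adaptPts_const {D : Type*} {n : ℕ} (p : Fin n → D) (f : D → ℝ) :
    adaptPts (fun j _ => p j) f = p := by
  funext j
  rw [adaptPts]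

/-- A function that vanishes at the points the algorithm computes for the zero function leads
the algorithm to the same points. -/
theorem adaptPts_eq_of_vanish {D : Type*} {n : ℕ}
    (x : (j : Fin n) → (Fin (j : ℕ) → ℝ) → D) (f : D → ℝ)
    (hf : ∀ i, f (adaptPts x 0 i) = 0) (j : Fin n) : adaptPts x f j = adaptPts x 0 j := by
  rw [adaptPts, adaptPts]
  congr 1
  funext i
  rw [adaptPts_eq_of_vanish x f hf ⟨(i : ℕ), i.isLt.trans j.isLt⟩, hf]
  rfl
  termination_by (j : ℕ)
  decreasing_by exact i.isLt

/-- A set of reals whose points differ by at most `2 * r` lies in an interval of radius `r`. -/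
theorem exists_center_of_sub_le (A : Set ℝ) (r : ℝ) (hA : ∀ a ∈ A, ∀ b ∈ A, a - b ≤ 2 * r) :
    ∃ c, ∀ a ∈ A, |a - c| ≤ r := by
  refine ⟨sSup A - r, fun a ha => abs_le.2 ⟨?_, ?_⟩⟩
  · have : sSup A ≤ a + 2 * r :=
      csSup_le ⟨a, ha⟩ fun b hb => by linarith [hA b hb a ha]
    linarith
  · have : a ≤ sSup A := le_csSup ⟨a + 2 * r, fun b hb => by linarith [hA b hb a ha]⟩ ha
    linarith

/-- Smolyak–Bakhvalov theorem: for a convex and symmetric class `F` and a linear functional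
`S` on the span of `F`, the minimal worst-case error (in `[0,∞]`) of arbitrary adaptive
algorithms using `n` function values equals
`inf_{x₁,…,xₙ ∈ D} sup{ S(f) : f ∈ F, f(x₁) = ⋯ = f(xₙ) = 0 }`. -/
theorem smolyak_bakhvalov {D : Type} [Nonempty D] (n : ℕ)
    (F : Set (D → ℝ)) (hconv : Convex ℝ F) (hsym : ∀ f ∈ F, -f ∈ F)
    (S : Submodule.span ℝ F →ₗ[ℝ] ℝ) :
    (⨅ x : (j : Fin n) → (Fin (j : ℕ) → ℝ) → D, ⨅ φ : (Fin n → ℝ) → ℝ,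
      ⨆ f : F, ENNReal.ofReal
        |S ⟨(f : D → ℝ), Submodule.subset_span f.2⟩ -
          φ (fun j => (f : D → ℝ) (adaptPts x (f : D → ℝ) j))|) =
    ⨅ x : Fin n → D, ⨆ f : F, ⨆ _ : ∀ i, (f : D → ℝ) (x i) = 0,
      ENNReal.ofReal (S ⟨(f : D → ℝ), Submodule.subset_span f.2⟩) := by
  apply le_antisymm
  · refine le_iInf fun p => ?_
    set r := ⨆ f : F, ⨆ _ : ∀ i, (f : D → ℝ) (p i) = 0,
      ENNReal.ofReal (S ⟨(f : D → ℝ), Submodule.subset_span f.2⟩)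
    by_cases hr_top : r = ⊤
    · rw [hr_top]
      exact le_top
    have hzero (f : F) (hf : ∀ i, (f : D → ℝ) (p i) = 0) :
        S ⟨(f : D → ℝ), Submodule.subset_span f.2⟩ ≤ r.toReal :=
      (ENNReal.ofReal_le_iff_le_toReal hr_top).1 (le_iSup₂_of_le f hf le_rfl)
    have hdiff (f g : F) (hfg : ∀ i, (f : D → ℝ) (p i) = (g : D → ℝ) (p i)) :
        S ⟨(f : D → ℝ), Submodule.subset_span f.2⟩ -
          S ⟨(g : D → ℝ), Submodule.subset_span g.2⟩ ≤ 2 * r.toReal := by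
      have hmem : (1 / 2 : ℝ) • (f : D → ℝ) + (1 / 2 : ℝ) • (-(g : D → ℝ)) ∈ F :=
        hconv f.2 (hsym _ g.2) (by norm_num) (by norm_num) (by norm_num)
      have hle := hzero ⟨_, hmem⟩ fun i => by simp [hfg i]
      have hS : S ⟨_, Submodule.subset_span hmem⟩ =
          (1 / 2 : ℝ) * S ⟨(f : D → ℝ), Submodule.subset_span f.2⟩ +
            (1 / 2 : ℝ) * -S ⟨(g : D → ℝ), Submodule.subset_span g.2⟩ := by
        rw [← map_neg, ← smul_eq_mul, ← smul_eq_mul, ← map_smul, ← map_smul, ← map_add]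
        rfl
      linarith
    have hcenter (y : Fin n → ℝ) : ∃ c : ℝ, ∀ f : F, (fun i => (f : D → ℝ) (p i)) = y →
        |S ⟨(f : D → ℝ), Submodule.subset_span f.2⟩ - c| ≤ r.toReal := by
      obtain ⟨c, hc⟩ := exists_center_of_sub_le
        {a | ∃ f : F, (fun i => (f : D → ℝ) (p i)) = y ∧
          S ⟨(f : D → ℝ), Submodule.subset_span f.2⟩ = a} r.toReal (by
            rintro _ ⟨f, hf, rfl⟩ _ ⟨g, hg, rfl⟩
            exact hdiff f g (congrFun (hf.trans hg.symm)))
      exact ⟨c, fun f hf => hc _ ⟨f, hf, rfl⟩⟩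
    choose φ hφ using hcenter
    refine iInf₂_le_of_le (fun j _ => p j) φ (iSup_le fun f => ?_)
    rw [adaptPts_const, ENNReal.ofReal_le_iff_le_toReal hr_top]
    exact hφ _ f rfl
  · refine le_iInf₂ fun x φ => iInf_le_of_le (adaptPts x 0) (iSup₂_le fun f hf => ?_)
    have hneg : ∀ i, (-(f : D → ℝ)) (adaptPts x 0 i) = 0 := fun i => by simp [hf i]
    have hSneg : S ⟨-(f : D → ℝ), Submodule.subset_span (hsym _ f.2)⟩ =
        -S ⟨(f : D → ℝ), Submodule.subset_span f.2⟩ := by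
      rw [← map_neg]
      rfl
    set s := S ⟨(f : D → ℝ), Submodule.subset_span f.2⟩
    have hmax : s ≤ |s - φ 0| ∨ s ≤ |-s - φ 0| := by
      by_contra! h
      linarith [le_abs_self (s - φ 0), neg_le_abs (-s - φ 0)]
    rcases hmax with h | h
    · refine le_iSup_of_le f (ENNReal.ofReal_le_ofReal (h.trans_eq ?_))
      simp only [adaptPts_eq_of_vanish x _ hf, hf]
      rfl
    · refine le_iSup_of_le ⟨_, hsym _ f.2⟩ (ENNReal.ofReal_le_ofReal (h.trans_eq ?_))
      simp only [adaptPts_eq_of_vanish x _ hneg, hneg, hSneg]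
      rfl
end

section
/- For every k ∈ ℕ there exists a constant c_{k,1} > 0 such that for all d, n ∈ ℕ one has e(n, F^k_d) ≥ min( 1/2 , c_{k,1} · d · n^{−k/d} ). -/
open MeasureTheory

/-- Iterated partial derivative in coordinate direction `i`. -/
noncomputable def pderiv' (d : ℕ) (i : Fin d) (f : (Fin d → ℝ) → ℝ) : (Fin d → ℝ) → ℝ :=
  fun x => fderiv ℝ f x (Pi.single i 1)

/-- The partial derivative `D^α f` for a multi-index `α`. -/
noncomputable def mderiv (d : ℕ) (α : Fin d → ℕ) (f : (Fin d → ℝ) → ℝ) : (Fin d → ℝ) → ℝ :=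
  ((List.finRange d).flatMap fun i => List.replicate (α i) i).foldr (pderiv' d) f

/-- The open unit cube `(0,1)^d`. -/
def unitCube (d : ℕ) : Set (Fin d → ℝ) := Set.univ.pi fun _ => Set.Ioo 0 1

/-- The class `F^k_d(D)` of `C^k` functions with all partial derivatives of order `≤ k`
bounded by one on `D`. -/
def Fkd (k d : ℕ) (D : Set (Fin d → ℝ)) : Set ((Fin d → ℝ) → ℝ) :=
  { f | ContDiffOn ℝ k f D ∧
      ∀ α : Fin d → ℕ, (∑ i, α i) ≤ k → ∀ x ∈ D, |mderiv d α f x| ≤ 1 }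

/-- The `n`-th minimal worst-case error of numerical integration on the class `F` over `D`:
`e(n,F) = inf_{x₁,…,xₙ ∈ D} sup{ ∫_D f : f ∈ F, f(x₁) = ⋯ = f(xₙ) = 0 }`. -/
noncomputable def interr {d : ℕ} (D : Set (Fin d → ℝ))
    (F : Set ((Fin d → ℝ) → ℝ)) (n : ℕ) : ℝ :=
  ⨅ x : Fin n → D, sSup ((fun f => ∫ t in D, f t) ''
    {f | f ∈ F ∧ ∀ i, f ((x i : Fin d → ℝ)) = 0})

open scoped Convolution ContDiff

section Derivatives

variable {d : ℕ}

/-- Partial derivative of a product of functions of the single coordinates. -/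
lemma pderiv'_prod (i : Fin d) (g : Fin d → ℝ → ℝ) (hg : ∀ j, Differentiable ℝ (g j)) :
    pderiv' d i (fun x => ∏ j, g j (x j)) =
      fun x => ∏ j, Function.update g i (deriv (g i)) j (x j) := by
  ext x
  have hj : ∀ j ∈ Finset.univ, HasFDerivAt (fun y : Fin d → ℝ => g j (y j))
      ((deriv (g j) (x j)) • ContinuousLinearMap.proj (R := ℝ) (φ := fun _ : Fin d => ℝ) j) x :=
    fun j _ => (hg j (x j)).hasDerivAt.comp_hasFDerivAt x (hasFDerivAt_apply j x)
  have h := HasFDerivAt.finsetProd (u := Finset.univ) hj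
  rw [pderiv', h.fderiv, sum_apply, Finset.sum_eq_single i]
  · rw [← Finset.mul_prod_erase Finset.univ _ (Finset.mem_univ i)]
    simp only [smul_apply, ContinuousLinearMap.proj_apply, Pi.single_eq_same,
      smul_eq_mul, mul_one, Function.update_self]
    rw [mul_comm]
    congr 1
    exact Finset.prod_congr rfl fun j hj => by
      rw [Function.update_of_ne (Finset.ne_of_mem_erase hj)]
  · intro j _ hji
    simp [Pi.single_eq_of_ne hji]
  · simp

/-- Iterated partial derivatives of a tensor power. -/
lemma foldr_pderiv'_prod {h : ℝ → ℝ} (hh : ContDiff ℝ ∞ h) (l : List (Fin d)) :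
    l.foldr (pderiv' d) (fun x => ∏ j, h (x j)) =
      fun x => ∏ j, iteratedDeriv (l.count j) h (x j) := by
  induction l with
  | nil => simp
  | cons i l ih =>
    rw [List.foldr_cons, ih, pderiv'_prod i (fun j => iteratedDeriv (l.count j) h)
      fun j => hh.differentiable_iteratedDeriv _ (by exact_mod_cast WithTop.coe_lt_top _)]
    ext x
    refine Finset.prod_congr rfl fun j _ => ?_
    rcases eq_or_ne j i with rfl | hji
    · simp [iteratedDeriv_succ]
    · simp [Function.update_of_ne hji, List.count_cons_of_ne hji.symm]

lemma contDiff_pderiv' (i : Fin d) {f : (Fin d → ℝ) → ℝ} (hf : ContDiff ℝ ∞ f) :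
    ContDiff ℝ ∞ (pderiv' d i f) :=
  (hf.fderiv_right (m := ∞) (by simp)).clm_apply contDiff_const

lemma hasCompactSupport_pderiv' (i : Fin d) {f : (Fin d → ℝ) → ℝ} (hf : HasCompactSupport f) :
    HasCompactSupport (pderiv' d i f) :=
  (hf.fderiv ℝ).comp_left (g := fun L : (Fin d → ℝ) →L[ℝ] ℝ => L (Pi.single i 1)) rfl

lemma contDiff_foldr_pderiv' {f : (Fin d → ℝ) → ℝ} (hf : ContDiff ℝ ∞ f) (l : List (Fin d)) :
    ContDiff ℝ ∞ (l.foldr (pderiv' d) f) := by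
  induction l with
  | nil => exact hf
  | cons i l ih => exact contDiff_pderiv' i ih

lemma hasCompactSupport_foldr_pderiv' {f : (Fin d → ℝ) → ℝ} (hf : HasCompactSupport f)
    (l : List (Fin d)) : HasCompactSupport (l.foldr (pderiv' d) f) := by
  induction l with
  | nil => exact hf
  | cons i l ih => exact hasCompactSupport_pderiv' i ih

/-- Partial derivatives of a convolution fall on the smooth factor. -/
lemma foldr_pderiv'_convolution {u φ : (Fin d → ℝ) → ℝ} (hu : Continuous u)
    (hφ : ContDiff ℝ ∞ φ) (hc : HasCompactSupport φ) (l : List (Fin d)) :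
    l.foldr (pderiv' d) (u ⋆[ContinuousLinearMap.mul ℝ ℝ] φ) =
      u ⋆[ContinuousLinearMap.mul ℝ ℝ] (l.foldr (pderiv' d) φ) := by
  induction l with
  | nil => rfl
  | cons i l ih =>
    have hs := contDiff_foldr_pderiv' hφ l
    have hk := hasCompactSupport_foldr_pderiv' hc l
    rw [List.foldr_cons, ih]
    ext x
    rw [pderiv', (hk.hasFDerivAt_convolution_right _ hu.locallyIntegrable
      (hs.of_le (by exact_mod_cast le_top)) x).fderiv,
      convolution_precompR_apply _ hu.locallyIntegrable (hk.fderiv ℝ)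
        (hs.continuous_fderiv (by simp))]
    rfl

/-- A directional Lipschitz bound for `u` gives a bound on the partial derivative of `u ⋆ φ`. -/
lemma abs_pderiv'_convolution_le {u φ : (Fin d → ℝ) → ℝ} (hu : Continuous u)
    (hφ : ContDiff ℝ ∞ φ) (hc : HasCompactSupport φ) (i : Fin d) {L : ℝ} (hL : 0 ≤ L)
    (hlip : ∀ x t, |u (x + t • Pi.single i 1) - u x| ≤ L * |t|) (x : Fin d → ℝ) :
    |pderiv' d i (u ⋆[ContinuousLinearMap.mul ℝ ℝ] φ) x| ≤ L * ∫ y, |φ y| := by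
  have hdiff : DifferentiableAt ℝ (u ⋆[ContinuousLinearMap.mul ℝ ℝ] φ) x :=
    (hc.hasFDerivAt_convolution_right _ hu.locallyIntegrable
      (hφ.of_le (by exact_mod_cast le_top)) x).differentiableAt
  have hline := hdiff.hasFDerivAt.hasLineDerivAt (Pi.single i 1)
  have hint : ∀ z, Integrable fun y => u (z - y) * φ y := fun z =>
    (by fun_prop : Continuous fun y => u (z - y) * φ y).integrable_of_hasCompactSupport
      hc.mul_left
  have hI : 0 ≤ ∫ y, |φ y| := integral_nonneg fun _ => abs_nonneg _
  have hφi : Integrable fun y => |φ y| :=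
    (hφ.continuous.integrable_of_hasCompactSupport hc).abs
  refine HasDerivAt.le_of_lip' hline (by positivity) (Filter.Eventually.of_forall fun t => ?_)
  simp only [convolution_mul_swap, zero_smul, add_zero, sub_zero]
  rw [← integral_sub (hint _) (hint _)]
  calc ‖∫ y, (u (x + t • Pi.single i 1 - y) * φ y - u (x - y) * φ y)‖
      ≤ ∫ y, (L * |t|) * |φ y| := by
        refine norm_integral_le_of_norm_le (hφi.const_mul _) (Filter.Eventually.of_forall fun y => ?_)
        rw [← sub_mul, Real.norm_eq_abs, abs_mul, add_sub_right_comm]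
        exact mul_le_mul_of_nonneg_right (hlip _ _) (abs_nonneg _)
    _ = L * (∫ y, |φ y|) * ‖t‖ := by
        rw [integral_const_mul, Real.norm_eq_abs]; ring

end Derivatives

section Kernel

/-- A smooth mollifier at scale `δ` whose derivatives of order `m ≤ k` have `L¹` norm at most
`(C / δ) ^ m`. -/
lemma exists_mollifier (k : ℕ) : ∃ C : ℝ, 1 ≤ C ∧ ∀ δ : ℝ, 0 < δ → ∃ h : ℝ → ℝ,
    ContDiff ℝ ∞ h ∧ (∀ t, 0 ≤ h t) ∧ ∫ t, h t = 1 ∧ (∀ t, h t ≠ 0 → |t| ≤ δ) ∧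
      ∀ m ≤ k, ∫ t, |iteratedDeriv m h t| ≤ (C / δ) ^ m := by
  let b : ContDiffBump (0 : ℝ) := ⟨1 / 2, 1, by norm_num, by norm_num⟩
  let ψ : ℝ → ℝ := b.normed volume
  have hψ : ContDiff ℝ ∞ ψ := b.contDiff_normed
  have hψ1 : ∫ t, ψ t = 1 := b.integral_normed
  have hnn : ∀ m, 0 ≤ ∫ t, |iteratedDeriv m ψ t| := fun m => integral_nonneg fun _ => abs_nonneg _
  set S := ∑ m ∈ Finset.range (k + 1), ∫ t, |iteratedDeriv m ψ t| with hS
  have hS0 : 0 ≤ S := Finset.sum_nonneg fun m _ => hnn m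
  refine ⟨1 + S, by linarith, fun δ hδ => ?_⟩
  have hδ' : 0 < δ⁻¹ := inv_pos.2 hδ
  have hsub : ∀ g : ℝ → ℝ, ∫ t, δ⁻¹ * g (δ⁻¹ * t) = ∫ t, g t := fun g => by
    rw [integral_const_mul, Measure.integral_comp_mul_left, inv_inv, abs_of_pos hδ, smul_eq_mul,
      inv_mul_cancel_left₀ hδ.ne']
  refine ⟨fun t => δ⁻¹ * ψ (δ⁻¹ * t), ?_, ?_, ?_, ?_, ?_⟩
  · exact contDiff_const.mul (hψ.comp (contDiff_const.mul contDiff_id))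
  · exact fun t => mul_nonneg hδ'.le (b.nonneg_normed _)
  · rw [hsub, hψ1]
  · intro t ht
    have h1 : δ⁻¹ * t ∈ Function.support (b.normed volume) := fun h => ht (by simp [ψ, h])
    rw [b.support_normed_eq, mem_ball_zero_iff, Real.norm_eq_abs, abs_mul, abs_of_pos hδ',
      inv_mul_lt_iff₀ hδ] at h1
    have h2 : b.rOut = 1 := rfl
    rw [h2, mul_one] at h1
    exact h1.le
  · intro m hm
    have h1 : ∀ t, |iteratedDeriv m (fun t => δ⁻¹ * ψ (δ⁻¹ * t)) t| =
        δ⁻¹ ^ m * (δ⁻¹ * |iteratedDeriv m ψ (δ⁻¹ * t)|) := fun t => by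
      rw [iteratedDeriv_const_mul_field,
        iteratedDeriv_comp_const_mul (hψ.of_le (by exact_mod_cast le_top)), abs_mul, abs_mul,
        abs_of_pos hδ', abs_of_pos (pow_pos hδ' m)]
      ring
    simp_rw [h1]
    rw [integral_const_mul, hsub fun t => |iteratedDeriv m ψ t|, div_eq_mul_inv, mul_pow, mul_comm]
    refine mul_le_mul_of_nonneg_right ?_ (by positivity)
    rcases Nat.eq_zero_or_pos m with rfl | hm0
    · simp only [iteratedDeriv_zero, pow_zero]
      rw [← hψ1]
      exact (integral_congr_ae (Filter.Eventually.of_forall fun t =>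
        abs_of_nonneg (b.nonneg_normed t))).le
    · calc ∫ t, |iteratedDeriv m ψ t| ≤ S :=
            Finset.single_le_sum (f := fun m => ∫ t, |iteratedDeriv m ψ t|) (fun m _ => hnn m)
              (Finset.mem_range.2 (Nat.lt_succ_of_le hm))
        _ ≤ 1 + S := by linarith
        _ ≤ (1 + S) ^ m := le_self_pow₀ (by linarith) hm0.ne'

/-- A smooth mollifier on `ℝ^d` supported in the cube of half side length `δ`, with `L¹` bounds on
its partial derivatives which do not depend on `d`. -/
lemma exists_mollifier_pi (k : ℕ) : ∃ C : ℝ, 1 ≤ C ∧ ∀ (d : ℕ) (δ : ℝ), 0 < δ →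
    ∃ φ : (Fin d → ℝ) → ℝ, ContDiff ℝ ∞ φ ∧ HasCompactSupport φ ∧ (∀ x, 0 ≤ φ x) ∧
      ∫ x, φ x = 1 ∧ (∀ x, φ x ≠ 0 → ∀ j, |x j| ≤ δ) ∧
      ∀ l : List (Fin d), l.length ≤ k →
        ∫ x, |l.foldr (pderiv' d) φ x| ≤ (C / δ) ^ l.length := by
  obtain ⟨C, hC, H⟩ := exists_mollifier k
  refine ⟨C, hC, fun d δ hδ => ?_⟩
  obtain ⟨h, hh, h0, h1, hsupp, hder⟩ := H δ hδ
  have hs : ∀ x : Fin d → ℝ, ∏ j, h (x j) ≠ 0 → ∀ j, |x j| ≤ δ := fun x hx j =>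
    hsupp _ (Finset.prod_ne_zero_iff.1 hx j (Finset.mem_univ j))
  refine ⟨fun x => ∏ j, h (x j), ?_, ?_, ?_, ?_, hs, ?_⟩
  · exact contDiff_prod fun j _ => hh.comp (contDiff_apply ℝ ℝ j)
  · refine HasCompactSupport.of_support_subset_isCompact
      (isCompact_closedBall (0 : Fin d → ℝ) δ) fun x hx => ?_
    rw [mem_closedBall_zero_iff, pi_norm_le_iff_of_nonneg hδ.le]
    exact hs x hx
  · exact fun x => Finset.prod_nonneg fun j _ => h0 _
  · rw [integral_fintype_prod_volume_eq_pow, h1, one_pow]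
  · intro l hl
    rw [foldr_pderiv'_prod hh]
    simp_rw [Finset.abs_prod]
    rw [integral_fintype_prod_volume_eq_prod fun j t => |iteratedDeriv (l.count j) h t|]
    have hlen : l.length = ∑ j, l.count j := by
      simpa using (Multiset.sum_count_eq_card (s := Finset.univ) (m := (l : Multiset (Fin d)))
        fun a _ => Finset.mem_univ a).symm
    rw [hlen, ← Finset.prod_pow_eq_pow_sum]
    exact Finset.prod_le_prod (fun j _ => integral_nonneg fun _ => abs_nonneg _)
      fun j _ => hder _ (List.count_le_length.trans hl)

end Kernel

section Cutoff

variable {d : ℕ}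

/-- An `ℓ¹`-Lipschitz function vanishing near finitely many points and equal to one away from
them. -/
lemma exists_cutoff {n : ℕ} (hn : 0 < n) (p : Fin n → Fin d → ℝ) (R : ℝ) {ρ : ℝ} (hρ : 0 < ρ) :
    ∃ u : (Fin d → ℝ) → ℝ, Continuous u ∧ (∀ x, 0 ≤ u x) ∧ (∀ x, u x ≤ 1) ∧
      (∀ x i, ∑ j, |x j - p i j| ≤ R → u x = 0) ∧
      (∀ x, (∀ i, R + ρ ≤ ∑ j, |x j - p i j|) → u x = 1) ∧
      ∀ x y, |u x - u y| ≤ (∑ j, |x j - y j|) / ρ := by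
  have : Nonempty (Fin n) := ⟨⟨0, hn⟩⟩
  let P : Set (PiLp 1 fun _ : Fin d => ℝ) := Set.range fun i => WithLp.toLp 1 (p i)
  have hP : P.Nonempty := Set.range_nonempty _
  let D : (Fin d → ℝ) → ℝ := fun x => Metric.infDist (WithLp.toLp 1 x) P
  have hdist : ∀ x y : Fin d → ℝ,
      dist (WithLp.toLp 1 x : PiLp 1 fun _ : Fin d => ℝ) (WithLp.toLp 1 y) = ∑ j, |x j - y j| :=
    fun x y => by simp [PiLp.dist_eq_of_L1, Real.dist_eq]
  have hD : Continuous D :=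
    (Metric.continuous_infDist_pt P).comp (PiLp.continuous_toLp 1 fun _ : Fin d => ℝ)
  have hDl : ∀ x y, D x - D y ≤ ∑ j, |x j - y j| := fun x y => by
    have := Metric.infDist_le_infDist_add_dist (s := P) (x := WithLp.toLp 1 x)
      (y := WithLp.toLp 1 y)
    rw [hdist] at this
    simp only [D]; linarith
  refine ⟨fun x => max 0 (min 1 ((D x - R) / ρ)), by fun_prop, fun x => le_max_left _ _,
    fun x => max_le zero_le_one (min_le_left _ _), fun x i hx => ?_, fun x hx => ?_,
    fun x y => ?_⟩
  · refine max_eq_left ((min_le_right _ _).trans (div_nonpos_of_nonpos_of_nonneg ?_ hρ.le))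
    have : D x ≤ ∑ j, |x j - p i j| := by
      rw [← hdist]; exact Metric.infDist_le_dist_of_mem (Set.mem_range_self i)
    linarith
  · have hx1 : R + ρ ≤ D x := by
      refine (Metric.le_infDist hP).2 ?_
      rintro _ ⟨i, rfl⟩
      rw [hdist]; exact hx i
    simp only
    rw [min_eq_left ((one_le_div hρ).2 (le_sub_iff_add_le'.2 hx1)), max_eq_right zero_le_one]
  · have h1 : |D x - D y| ≤ ∑ j, |x j - y j| := abs_sub_le_iff.2
      ⟨hDl x y, (hDl y x).trans_eq (Finset.sum_congr rfl fun j _ => abs_sub_comm _ _)⟩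
    calc _ ≤ |min 1 ((D x - R) / ρ) - min 1 ((D y - R) / ρ)| := by
          simpa using abs_max_sub_max_le_max 0 (min 1 ((D x - R) / ρ)) 0 (min 1 ((D y - R) / ρ))
      _ ≤ |(D x - R) / ρ - (D y - R) / ρ| := by
          simpa using abs_min_sub_min_le_max 1 ((D x - R) / ρ) 1 ((D y - R) / ρ)
      _ = |D x - D y| / ρ := by
          rw [← sub_div, abs_div, abs_of_pos hρ, sub_sub_sub_cancel_right]
      _ ≤ _ := by gcongr

/-- The volume of an `ℓ¹` ball of radius `r * d` is at most `(2 e r) ^ d`. -/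
lemma volume_l1_ball_le (hd : 0 < d) (p : Fin d → ℝ) {r : ℝ} (hr : 0 ≤ r) :
    volume {x : Fin d → ℝ | ∑ j, |x j - p j| < r * d} ≤
      ENNReal.ofReal ((2 * Real.exp 1 * r) ^ d) := by
  have : Nonempty (Fin d) := ⟨⟨0, hd⟩⟩
  have h1 : {x : Fin d → ℝ | ∑ j, |x j - p j| < r * d} =
      (fun x => x + -p) ⁻¹' {x : Fin d → ℝ | (∑ j, |x j| ^ (1 : ℝ)) ^ (1 / (1 : ℝ)) < r * d} := by
    ext x; simp [sub_eq_add_neg]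
  rw [h1, measure_preimage_add_right, volume_sum_rpow_lt _ le_rfl,
    ← ENNReal.ofReal_pow (by positivity), ← ENNReal.ofReal_mul (by positivity)]
  refine ENNReal.ofReal_le_ofReal ?_
  have h2 := Real.pow_div_factorial_le_exp (d : ℝ) (Nat.cast_nonneg d) d
  rw [Fintype.card_fin, div_one, div_one, Real.Gamma_nat_eq_factorial, one_add_one_eq_two,
    Real.Gamma_two]
  calc (r * d) ^ d * ((2 * 1) ^ d / d.factorial) = (2 * r) ^ d * ((d : ℝ) ^ d / d.factorial) := by
        rw [mul_pow, mul_pow 2 r, mul_one]; ring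
    _ ≤ (2 * r) ^ d * Real.exp d := by gcongr
    _ = (2 * Real.exp 1 * r) ^ d := by
        rw [← mul_one (d : ℝ), Real.exp_nat_mul, ← mul_pow]; ring

end Cutoff

section Fooling

variable {d : ℕ}

/-- A smooth function with all partial derivatives up to order `k` bounded by one, vanishing at
given points, and equal to `min 1 (d (δ / C) ^ k)` at `ℓ¹` distance `3 δ d` from these points. -/
lemma exists_fooling_function (k : ℕ) : ∃ C : ℝ, 1 ≤ C ∧ ∀ (d n : ℕ), 0 < d → 0 < n →
    ∀ (δ : ℝ), 0 < δ → δ ≤ 1 → ∀ p : Fin n → Fin d → ℝ,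
    ∃ f : (Fin d → ℝ) → ℝ, ContDiff ℝ ∞ f ∧ (∀ x, 0 ≤ f x) ∧ (∀ i, f (p i) = 0) ∧
      (∀ x, (∀ i, 3 * δ * d ≤ ∑ j, |x j - p i j|) → f x = min 1 (d * (δ / C) ^ k)) ∧
      ∀ l : List (Fin d), l.length ≤ k → ∀ x, |l.foldr (pderiv' d) f x| ≤ 1 := by
  obtain ⟨C, hC, hmol⟩ := exists_mollifier_pi k
  refine ⟨C, hC, fun d n hd hn δ hδ hδ1 p => ?_⟩
  obtain ⟨φ, hφ, hc, hφ0, hφ1, hsupp, hder⟩ := hmol d δ hδ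
  have hd' : (0 : ℝ) < d := Nat.cast_pos.2 hd
  have hC0 : 0 < C := by linarith
  obtain ⟨u, hu, hu0, hu1, huR, huρ, hlip⟩ := exists_cutoff hn p (δ * d) (mul_pos hδ hd')
  set H : ℝ := min 1 (d * (δ / C) ^ k) with hH
  have hH0 : 0 ≤ H := le_min zero_le_one (by positivity)
  have hsum : ∀ y, φ y ≠ 0 → ∑ j, |y j| ≤ δ * d := fun y hy => by
    refine (Finset.sum_le_card_nsmul _ _ δ fun j _ => hsupp y hy j).trans_eq ?_
    simp [mul_comm]
  have hU : Continuous fun x => H * u x := hu.const_mul H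
  have hint : Integrable φ := hφ.continuous.integrable_of_hasCompactSupport hc
  set f : (Fin d → ℝ) → ℝ := (fun x => H * u x) ⋆[ContinuousLinearMap.mul ℝ ℝ] φ with hf
  have hfx : ∀ x, f x = ∫ y, H * u (x - y) * φ y := fun x => convolution_mul_swap
  have hf0 : ∀ x, 0 ≤ f x := fun x => by
    rw [hfx]
    exact integral_nonneg fun y => mul_nonneg (mul_nonneg hH0 (hu0 _)) (hφ0 y)
  refine ⟨f, hc.contDiff_convolution_right _ hU.locallyIntegrable hφ, hf0, fun i => ?_,
    fun x hx => ?_, fun l hl x => ?_⟩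
  · rw [hfx, integral_eq_zero_of_ae (Filter.Eventually.of_forall fun y => ?_)]
    by_cases hy : φ y = 0
    · simp [hy]
    · have : u (p i - y) = 0 := huR _ i (by simpa using hsum y hy)
      simp [this]
  · have : ∀ y, H * u (x - y) * φ y = H * φ y := fun y => by
      by_cases hy : φ y = 0
      · simp [hy]
      · rw [huρ _ fun i => ?_, mul_one]
        have h1 : ∑ j, |x j - p i j| ≤ ∑ j, |(x - y) j - p i j| + ∑ j, |y j| := by
          rw [← Finset.sum_add_distrib]
          refine Finset.sum_le_sum fun j _ => ?_
          calc |x j - p i j| = |((x - y) j - p i j) + y j| := by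
                congr 1; simp only [Pi.sub_apply]; ring
            _ ≤ _ := abs_add_le _ _
        linarith [hx i, hsum y hy]
    rw [hfx]
    simp_rw [this]
    rw [integral_const_mul, hφ1, mul_one]
  · cases l with
    | nil =>
      rw [List.foldr_nil, abs_of_nonneg (hf0 x), hfx, ← hφ1]
      refine integral_mono_of_nonneg (Filter.Eventually.of_forall fun y =>
        mul_nonneg (mul_nonneg hH0 (hu0 _)) (hφ0 y)) hint
        (Filter.Eventually.of_forall fun y => ?_)
      exact mul_le_of_le_one_left (hφ0 y) (mul_le_one₀ (min_le_left _ _) (hu0 _) (hu1 _))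
    | cons i l =>
      rw [List.length_cons] at hl
      have hL : 0 ≤ H / (δ * d) := by positivity
      have hlip' : ∀ (x : Fin d → ℝ) (t : ℝ),
          |H * u (x + t • Pi.single i 1) - H * u x| ≤ H / (δ * d) * |t| := fun x t => by
        rw [← mul_sub, abs_mul, abs_of_nonneg hH0, div_mul_eq_mul_div, mul_div_assoc]
        refine mul_le_mul_of_nonneg_left ((hlip _ _).trans_eq ?_) hH0
        congr 1
        rw [Finset.sum_eq_single i]
        · simp
        · intro j _ hji
          simp [Pi.single_eq_of_ne hji]
        · simp
      rw [List.foldr_cons, hf, foldr_pderiv'_convolution hU hφ hc]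
      have hq0 : 0 ≤ δ / C := by positivity
      have hqδ : δ / C ≤ δ := div_le_self hδ.le hC
      have hHle : H ≤ d * (δ * (δ / C) ^ l.length) :=
        calc H ≤ d * (δ / C) ^ k := min_le_right _ _
          _ ≤ d * (δ / C) ^ (l.length + 1) := by
            gcongr ?_ * ?_
            exact pow_le_pow_of_le_one hq0 (hqδ.trans hδ1) hl
          _ ≤ d * (δ * (δ / C) ^ l.length) := by
            rw [pow_succ']; gcongr
      calc _ ≤ H / (δ * d) * ∫ y, |l.foldr (pderiv' d) φ y| :=
            abs_pderiv'_convolution_le hU (contDiff_foldr_pderiv' hφ l)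
              (hasCompactSupport_foldr_pderiv' hc l) i hL hlip' x
        _ ≤ d * (δ * (δ / C) ^ l.length) / (δ * d) * (C / δ) ^ l.length := by
            gcongr
            exact hder l (by omega)
        _ = ((δ / C) * (C / δ)) ^ l.length := by
            rw [mul_pow]; field_simp
        _ = 1 := by
            rw [div_mul_div_cancel₀ hC0.ne', div_self hδ.ne', one_pow]

lemma volume_unitCube : volume (unitCube d) = 1 := by
  simp [unitCube, Real.volume_pi_Ioo]

lemma volume_real_unitCube : volume.real (unitCube d) = 1 := by
  simp [Measure.real, volume_unitCube]

/-- The integrals of functions in `Fkd` over the unit cube are bounded. -/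
lemma bddAbove_integral_Fkd (k : ℕ) (F : Set ((Fin d → ℝ) → ℝ)) (hF : F ⊆ Fkd k d (unitCube d)) :
    BddAbove ((fun f => ∫ t in unitCube d, f t) '' F) := by
  refine ⟨1, ?_⟩
  rintro _ ⟨f, hf, rfl⟩
  have h0 : mderiv d 0 f = f := by
    have h : ((List.finRange d).flatMap fun i => List.replicate ((0 : Fin d → ℕ) i) i) = [] :=
      List.flatMap_eq_nil_iff.2 fun _ _ => rfl
    rw [mderiv, h, List.foldr_nil]
  have h1 : ∀ x ∈ unitCube d, ‖f x‖ ≤ 1 := fun x hx => by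
    simpa [h0] using (hF hf).2 0 (by simp) x hx
  have h2 := norm_setIntegral_le_of_norm_le_const (μ := volume)
    (by simp [volume_unitCube]) h1
  rw [volume_real_unitCube, mul_one] at h2
  exact (le_abs_self _).trans h2

lemma length_flatMap_replicate (α : Fin d → ℕ) :
    ((List.finRange d).flatMap fun i => List.replicate (α i) i).length = ∑ i, α i := by
  simp [List.length_flatMap, Fin.sum_univ_def]

/-- The union of `n` small `ℓ¹` balls has small volume. -/
lemma volume_iUnion_l1_ball_le {n : ℕ} (hd : 0 < d) (p : Fin n → Fin d → ℝ) {r : ℝ} (hr : 0 ≤ r) :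
    volume (⋃ i, {x : Fin d → ℝ | ∑ j, |x j - p i j| < r * d}) ≤
      ENNReal.ofReal (n * (2 * Real.exp 1 * r) ^ d) := by
  refine (measure_iUnion_fintype_le _ _).trans
    ((Finset.sum_le_sum fun i _ => volume_l1_ball_le hd (p i) hr).trans_eq ?_)
  rw [Finset.sum_const, Finset.card_univ, Fintype.card_fin, nsmul_eq_mul,
    ENNReal.ofReal_mul (Nat.cast_nonneg n), ENNReal.ofReal_natCast]

/-- A nonnegative function equal to `H` outside `n` small `ℓ¹` balls has integral at least
`H / 2`. -/
lemma half_le_setIntegral {n : ℕ} (hd : 0 < d) (p : Fin n → Fin d → ℝ) {r H : ℝ} (hr : 0 ≤ r)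
    (hH : 0 ≤ H) (hrn : n * (2 * Real.exp 1 * r) ^ d ≤ 1 / 2) {f : (Fin d → ℝ) → ℝ}
    (hf : IntegrableOn f (unitCube d)) (hf0 : ∀ x, 0 ≤ f x)
    (hfH : ∀ x, (∀ i, r * d ≤ ∑ j, |x j - p i j|) → f x = H) :
    H / 2 ≤ ∫ x in unitCube d, f x := by
  let B : Set (Fin d → ℝ) := ⋃ i, {x | ∑ j, |x j - p i j| < r * d}
  have hBm : MeasurableSet B := MeasurableSet.iUnion fun i =>
    (isOpen_lt (by fun_prop) continuous_const).measurableSet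
  have hQm : MeasurableSet (unitCube d) := MeasurableSet.univ_pi fun _ => measurableSet_Ioo
  have hB : volume B ≤ ENNReal.ofReal (1 / 2) :=
    (volume_iUnion_l1_ball_le hd p hr).trans (ENNReal.ofReal_le_ofReal hrn)
  have hBr : volume.real B ≤ 1 / 2 := ENNReal.toReal_le_of_le_ofReal (by norm_num) hB
  have hdiff : 1 / 2 ≤ volume.real (unitCube d \ B) := by
    have := le_measureReal_sdiff (μ := volume) (s₁ := unitCube d) (s₂ := B)
      (ne_top_of_le_ne_top ENNReal.ofReal_ne_top hB)
    rw [volume_real_unitCube] at this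
    linarith
  calc H / 2 ≤ volume.real (unitCube d \ B) * H := by
        rw [div_eq_inv_mul, ← one_div]; exact mul_le_mul_of_nonneg_right hdiff hH
    _ = ∫ x in unitCube d \ B, f x := by
        rw [setIntegral_congr_fun (g := fun _ => H) (hQm.diff hBm) fun x hx => ?_,
          setIntegral_const, smul_eq_mul]
        refine hfH x fun i => not_lt.1 fun h => hx.2 (Set.mem_iUnion.2 ⟨i, h⟩)
    _ ≤ ∫ x in unitCube d, f x :=
        setIntegral_mono_set hf (Filter.Eventually.of_forall hf0)
          (LE.le.eventuallyLE Set.sdiff_subset)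

end Fooling

/-- For every `k` there is `c_{k,1} > 0` with
`e(n, F^k_d) ≥ min(1/2, c_{k,1} · d · n^{-k/d})` for all `d, n ≥ 1`. -/
theorem lower_bound_Fkd (k : ℕ) (hk : 0 < k) :
    ∃ c : ℝ, 0 < c ∧ ∀ d n : ℕ, 0 < d → 0 < n →
      min (1 / 2) (c * d * (n : ℝ) ^ (-(k : ℝ) / d)) ≤
        interr (unitCube d) (Fkd k d (unitCube d)) n := by
  obtain ⟨C, hC, hfool⟩ := exists_fooling_function k
  have hC0 : 0 < C := by linarith
  have he : 1 ≤ Real.exp 1 := Real.one_le_exp zero_le_one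
  have he0 : 0 < Real.exp 1 := Real.exp_pos 1
  refine ⟨1 / 2 * (1 / (12 * Real.exp 1 * C)) ^ k, by positivity, fun d n hd hn => ?_⟩
  have hn1 : (1 : ℝ) ≤ n := Nat.one_le_cast.2 hn
  have hn0 : (0 : ℝ) < n := by linarith
  have hd0 : (d : ℝ) ≠ 0 := Nat.cast_ne_zero.2 hd.ne'
  set s : ℝ := (n : ℝ) ^ (-1 / (d : ℝ)) with hs
  have hs0 : 0 < s := Real.rpow_pos_of_pos hn0 _
  have hs1 : s ≤ 1 := Real.rpow_le_one_of_one_le_of_nonpos hn1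
    (div_nonpos_of_nonpos_of_nonneg (by norm_num) (Nat.cast_nonneg d))
  have hsk : (n : ℝ) ^ (-(k : ℝ) / d) = s ^ k := by
    rw [hs, ← Real.rpow_mul_natCast hn0.le]; congr 1; ring
  have hsd : n * s ^ d = 1 := by
    rw [hs, ← Real.rpow_mul_natCast hn0.le, div_mul_cancel₀ _ hd0, Real.rpow_neg_one,
      mul_inv_cancel₀ hn0.ne']
  set δ : ℝ := s / (12 * Real.exp 1) with hδ
  have hδ0 : 0 < δ := by positivity
  have hδ1 : δ ≤ 1 := (div_le_one (by positivity)).2 (by linarith)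
  have : Nonempty (Fin n → unitCube d) :=
    ⟨fun _ => ⟨fun _ => 1 / 2, fun _ _ => by constructor <;> norm_num⟩⟩
  refine le_ciInf fun p => ?_
  obtain ⟨f, hf, hf0, hfp, hfH, hfder⟩ := hfool d n hd hn δ hδ0 hδ1 fun i => (p i : Fin d → ℝ)
  have hF : f ∈ Fkd k d (unitCube d) := by
    refine ⟨(hf.of_le (by exact_mod_cast le_top)).contDiffOn, fun α hα x _ => hfder _ ?_ x⟩
    rwa [length_flatMap_replicate]
  have hfint : IntegrableOn f (unitCube d) := by
    refine (hf.continuous.continuousOn.integrableOn_compact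
      (isCompact_univ_pi fun _ => isCompact_Icc (a := (0 : ℝ)) (b := 1))).mono_set ?_
    exact Set.pi_mono fun _ _ => Set.Ioo_subset_Icc_self
  have hrn : n * (2 * Real.exp 1 * (3 * δ)) ^ d ≤ 1 / 2 := by
    have h1 : 2 * Real.exp 1 * (3 * δ) = s * (1 / 2) := by
      rw [hδ]; field_simp; norm_num
    rw [h1, mul_pow, ← mul_assoc, hsd, one_mul]
    exact pow_le_of_le_one (by norm_num) (by norm_num) hd.ne'
  have hH : min (1 / 2) (1 / 2 * (1 / (12 * Real.exp 1 * C)) ^ k * d * s ^ k) =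
      min 1 (d * (δ / C) ^ k) / 2 := by
    have h1 : δ / C = 1 / (12 * Real.exp 1 * C) * s := by
      rw [hδ]; field_simp
    rw [h1, mul_pow, ← min_div_div_right zero_le_two]
    congr 1; ring
  rw [hsk, hH]
  refine (half_le_setIntegral hd (fun i => (p i : Fin d → ℝ)) (by positivity)
    (le_min zero_le_one (by positivity)) hrn hfint hf0 hfH).trans ?_
  exact le_csSup (bddAbove_integral_Fkd k _ fun g hg => hg.1) ⟨f, ⟨hF, hfp⟩, rfl⟩
end

section
/- For every k ∈ ℕ there exists a constant c_{k,2} > 0 such that for all d, m ∈ ℕ and n = m^d one has e(n, F^k_d) ≤ min( 1 , c_{k,2} · d · n^{−k/d} ). -/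
open MeasureTheory

open Set in
/-- A positive quadrature rule on `[0,1]` with `k + 1` nodes, exact on polynomials of degree
less than `k`. -/
lemma exists_positive_quadrature (k : ℕ) :
    ∃ w z : Fin (k + 1) → ℝ, (∀ i, 0 ≤ w i) ∧ ∑ i, w i = 1 ∧ (∀ i, z i ∈ Icc (0 : ℝ) 1) ∧
      ∀ j < k, ∑ i, w i * z i ^ j = ∫ t in (0 : ℝ)..1, t ^ j := by
  let γ : ℝ → (Fin k → ℝ) := fun t j => t ^ (j : ℕ)
  have hγ : Continuous γ := by fun_prop
  let Φ : (Fin (k + 1) → ℝ) × (Fin (k + 1) → ℝ) → (Fin k → ℝ) :=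
    fun q => ∑ i, q.1 i • γ (q.2 i)
  have hΦ : Continuous Φ := by fun_prop
  let K : Set (Fin k → ℝ) := Φ '' (stdSimplex ℝ (Fin (k + 1)) ×ˢ univ.pi fun _ => Icc (0 : ℝ) 1)
  have hK : IsCompact K :=
    ((isCompact_stdSimplex ℝ _).prod (isCompact_univ_pi fun _ => isCompact_Icc)).image hΦ
  have hsub : convexHull ℝ (γ '' Icc 0 1) ⊆ K := by
    intro y hy
    obtain ⟨ι, _, z, w, hz, haff, hw, hw1, hsum⟩ := eq_pos_convex_span_of_mem_convexHull hy
    have hcard : Fintype.card ι ≤ Fintype.card (Fin (k + 1)) := by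
      have := haff.card_le_finrank_succ
      have h2 := Submodule.finrank_le (vectorSpan ℝ (range z))
      simp only [Module.finrank_fintype_fun_eq_card, Fintype.card_fin] at h2 ⊢
      omega
    obtain ⟨e⟩ := Function.Embedding.nonempty_of_card_le hcard
    have hz' : ∀ i, ∃ t ∈ Icc (0 : ℝ) 1, γ t = z i := fun i => hz (mem_range_self i)
    choose t ht htz using hz'
    have hwe : ∀ i ∉ range e, Function.extend e w 0 i = 0 := fun i hi =>
      Function.extend_apply' _ _ _ hi
    refine ⟨(Function.extend e w 0, Function.extend e t 0), ⟨⟨fun i => ?_, ?_⟩, fun i _ => ?_⟩, ?_⟩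
    · by_cases hi : i ∈ range e
      · obtain ⟨a, rfl⟩ := hi
        simpa [e.injective.extend_apply] using (hw a).le
      · exact (hwe i hi).ge
    · rw [← hw1]
      exact (Fintype.sum_of_injective e e.injective _ _ hwe
        fun i => (e.injective.extend_apply _ _ i).symm).symm
    · by_cases hi : i ∈ range e
      · obtain ⟨a, rfl⟩ := hi
        simpa [e.injective.extend_apply] using ht a
      · simp [Function.extend_apply' _ _ _ (show ¬ ∃ a, e a = i from hi)]
    · rw [← hsum]
      refine (Fintype.sum_of_injective e e.injective _ _ (fun i hi => ?_) fun i => ?_).symm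
      · simp [hwe i hi]
      · simp [e.injective.extend_apply, htz]
  have hint : ∀ f : ℝ → (Fin k → ℝ), Continuous f → IntegrableOn f (Ioc 0 1) := fun f hf =>
    (hf.integrableOn_Icc).mono_set Ioc_subset_Icc_self
  have hmem : (⨍ t in Ioc (0 : ℝ) 1, γ t) ∈ K := by
    refine closure_minimal hsub hK.isClosed ?_
    refine (convex_convexHull ℝ _).set_average_mem_closure (by simp) (by simp) ?_ (hint γ hγ)
    refine (ae_restrict_mem measurableSet_Ioc).mono fun t ht => subset_convexHull ℝ _ ?_
    exact mem_image_of_mem γ (Ioc_subset_Icc_self ht)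
  obtain ⟨⟨w, z⟩, ⟨⟨hw, hw1⟩, hz⟩, hwz⟩ := hmem
  refine ⟨w, z, hw, hw1, fun i => hz i (mem_univ i), fun j hj => ?_⟩
  have := congrFun hwz ⟨j, hj⟩
  rw [setAverage_eq] at this
  simp only [Real.volume_real_Ioc, Φ, γ] at this
  norm_num at this
  rw [eval_integral (fun i => ?_)] at this
  · rw [this, intervalIntegral.integral_of_le zero_le_one]
  · exact ((by fun_prop : Continuous fun t : ℝ => t ^ (i : ℕ)).integrableOn_Icc).mono_set
      Ioc_subset_Icc_self

open Set in
/-- Local error of a positive quadrature rule transplanted to a short interval. -/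
lemma panel_error {n : ℕ} {ι : Type*} [Fintype ι] {w z : ι → ℝ} (hw : ∀ i, 0 ≤ w i)
    (hw1 : ∑ i, w i = 1) (hz : ∀ i, z i ∈ Icc (0 : ℝ) 1)
    (hex : ∀ j < n + 1, ∑ i, w i * z i ^ j = ∫ t in (0 : ℝ)..1, t ^ j)
    {g : ℝ → ℝ} (hg : ContDiffOn ℝ (n + 1 : ℕ) g (Ioo 0 1))
    (hgb : ∀ t ∈ Ioo (0 : ℝ) 1, |iteratedDeriv (n + 1) g t| ≤ 1)
    {a h : ℝ} (ha : 0 < a) (hh : 0 < h) (hah : a + h < 1) :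
    |(∫ t in a..a + h, g t) - h * ∑ i, w i * g (a + h * z i)| ≤ 2 * h ^ (n + 1) * h := by
  have hab : a < a + h := by linarith
  have hsub : Icc a (a + h) ⊆ Ioo 0 1 := fun t ht => ⟨by linarith [ht.1], by linarith [ht.2]⟩
  have hgI : ContDiffOn ℝ (n + 1 : ℕ) g (Icc a (a + h)) := hg.mono hsub
  set P := fun t => taylorWithinEval g n (Icc a (a + h)) a t with hP
  have hPsum : ∀ t, P t = ∑ j ∈ Finset.range (n + 1),
      (t - a) ^ j * ((j.factorial : ℝ)⁻¹ * iteratedDerivWithin j g (Icc a (a + h)) a) := by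
    intro t
    rw [hP]
    simp only [taylor_within_apply, smul_eq_mul]
    exact Finset.sum_congr rfl fun j _ => by ring
  have hPc : Continuous P := by
    rw [funext hPsum]
    fun_prop
  have hrem : ∀ t ∈ Icc a (a + h), |g t - P t| ≤ h ^ (n + 1) := by
    intro t ht
    have h1 := taylor_mean_remainder_bound (C := 1) hab.le (by exact_mod_cast hgI) ht
      (fun y hy => by
        rw [iteratedDerivWithin_eq_iteratedDeriv (uniqueDiffOn_Icc hab)
          (hg.contDiffAt (isOpen_Ioo.mem_nhds (hsub hy))) hy]
        exact hgb y (hsub hy))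
    refine h1.trans ?_
    rw [one_mul]
    refine (div_le_self (pow_nonneg (by linarith [ht.1]) _)
      (by exact_mod_cast n.factorial_pos)).trans ?_
    exact pow_le_pow_left₀ (by linarith [ht.1]) (by linarith [ht.2]) _
  have hmono : ∀ j < n + 1, ∫ t in a..a + h, (t - a) ^ j =
      h * ∑ i, w i * (h * z i) ^ j := by
    intro j hj
    have h1 := intervalIntegral.integral_comp_add_mul (a := 0) (b := 1)
      (fun t : ℝ => (t - a) ^ j) hh.ne' a
    simp only [mul_zero, mul_one, add_zero, add_sub_cancel_left, smul_eq_mul] at h1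
    rw [eq_inv_mul_iff_mul_eq₀ hh.ne'] at h1
    rw [← h1]
    simp only [mul_pow, intervalIntegral.integral_const_mul, ← hex j hj, Finset.mul_sum]
    exact Finset.sum_congr rfl fun i _ => by ring
  have hPex : ∫ t in a..a + h, P t = h * ∑ i, w i * P (a + h * z i) := by
    simp only [hPsum]
    rw [intervalIntegral.integral_finsetSum fun j _ =>
      (by fun_prop : Continuous fun t : ℝ => (t - a) ^ j * _).intervalIntegrable _ _]
    simp only [intervalIntegral.integral_mul_const, Finset.mul_sum, add_sub_cancel_left]
    rw [Finset.sum_comm]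
    refine Finset.sum_congr rfl fun j hj => ?_
    rw [hmono j (Finset.mem_range.mp hj), Finset.mul_sum, Finset.sum_mul]
    exact Finset.sum_congr rfl fun i _ => by ring
  have hgi : IntervalIntegrable g volume a (a + h) :=
    (hgI.continuousOn.mono (by rw [uIcc_of_le hab.le])).intervalIntegrable
  have e1 : |∫ t in a..a + h, (g t - P t)| ≤ h ^ (n + 1) * h := by
    have := intervalIntegral.norm_integral_le_of_norm_le_const (a := a) (b := a + h)
      (f := fun t => g t - P t) (C := h ^ (n + 1)) (fun t ht => by
        rw [uIoc_of_le hab.le] at ht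
        exact hrem t (Ioc_subset_Icc_self ht))
    simpa [abs_of_pos hh] using this
  have e2 : |∑ i, w i * (g (a + h * z i) - P (a + h * z i))| ≤ h ^ (n + 1) := by
    calc _ ≤ ∑ i, |w i * (g (a + h * z i) - P (a + h * z i))| := Finset.abs_sum_le_sum_abs _ _
      _ ≤ ∑ i, w i * h ^ (n + 1) := Finset.sum_le_sum fun i _ => by
          rw [abs_mul, abs_of_nonneg (hw i)]
          refine mul_le_mul_of_nonneg_left (hrem _ ⟨?_, ?_⟩) (hw i)
          · nlinarith [(hz i).1]
          · nlinarith [(hz i).2]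
      _ = h ^ (n + 1) := by rw [← Finset.sum_mul, hw1, one_mul]
  rw [intervalIntegral.integral_sub hgi (hPc.intervalIntegrable _ _), hPex] at e1
  simp only [mul_sub, Finset.sum_sub_distrib] at e2
  set A := ∫ t in a..a + h, g t
  set B := ∑ i, w i * g (a + h * z i)
  set Q := ∑ i, w i * P (a + h * z i)
  have e3 : |h * (B - Q)| ≤ h * h ^ (n + 1) := by
    rw [abs_mul, abs_of_pos hh]
    exact mul_le_mul_of_nonneg_left e2 hh.le
  calc |A - h * B| = |(A - h * Q) - h * (B - Q)| := by ring_nf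
    _ ≤ |A - h * Q| + |h * (B - Q)| := abs_sub _ _
    _ ≤ _ := by linarith

open Set in
/-- Composite positive quadrature with `p` panels for smooth functions on `(0,1)`; the rule uses
only nodes in the interior. -/
lemma composite_quadrature_error {n p : ℕ} (hp : 0 < p) {ι : Type*} [Fintype ι] {w z : ι → ℝ}
    (hw : ∀ i, 0 ≤ w i) (hw1 : ∑ i, w i = 1) (hz : ∀ i, z i ∈ Icc (0 : ℝ) 1)
    (hex : ∀ j < n + 1, ∑ i, w i * z i ^ j = ∫ t in (0 : ℝ)..1, t ^ j)
    {ε h : ℝ} (hε : 0 < ε) (hh : 0 < h) (hph : p * h = 1 - 2 * ε)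
    {g : ℝ → ℝ} (hg : ContDiffOn ℝ (n + 1 : ℕ) g (Ioo 0 1))
    (hg0 : ∀ t ∈ Ioo (0 : ℝ) 1, |g t| ≤ 1)
    (hgb : ∀ t ∈ Ioo (0 : ℝ) 1, |iteratedDeriv (n + 1) g t| ≤ 1) :
    |(∫ t in Ioo (0 : ℝ) 1, g t) -
      ∑ q : Fin p, ∑ i, w i / p * g (ε + q * h + h * z i)| ≤ 2 * h ^ (n + 1) + 4 * ε := by
  have hp' : (0 : ℝ) < p := by exact_mod_cast hp
  have hph0 : 0 < p * h := by positivity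
  have hε1 : ε < 1 - ε := by linarith
  have hint : IntegrableOn g (Ioo 0 1) :=
    Integrable.of_bound (hg.continuousOn.aestronglyMeasurable measurableSet_Ioo) 1
      ((ae_restrict_mem measurableSet_Ioo).mono hg0)
  have hintI : IntegrableOn g (Icc 0 1) := (integrableOn_Icc_iff_integrableOn_Ioo).mpr hint
  have hii : ∀ a b : ℝ, a ∈ Icc (0 : ℝ) 1 → b ∈ Icc (0 : ℝ) 1 →
      IntervalIntegrable g volume a b := fun a b ha hb =>
    intervalIntegrable_iff.mpr (hintI.mono_set (uIoc_subset_uIcc.trans (uIcc_subset_Icc ha hb)))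
  have hsplit : (∫ t in Ioo (0 : ℝ) 1, g t) =
      (∫ t in (0 : ℝ)..ε, g t) + (∫ t in ε..1 - ε, g t) + ∫ t in (1 - ε)..1, g t := by
    rw [intervalIntegral.integral_add_adjacent_intervals (hii _ _ _ _) (hii _ _ _ _),
      intervalIntegral.integral_add_adjacent_intervals (hii _ _ _ _) (hii _ _ _ _),
      intervalIntegral.integral_of_le zero_le_one, integral_Ioc_eq_integral_Ioo]
    all_goals constructor <;> linarith
  have hend : ∀ a b : ℝ, 0 ≤ a → a ≤ b → b ≤ 1 → |∫ t in a..b, g t| ≤ b - a := by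
    intro a b ha hab hb
    rw [intervalIntegral.integral_of_le hab, integral_Ioc_eq_integral_Ioo]
    have := norm_setIntegral_le_of_norm_le_const (μ := volume) (s := Ioo a b) (f := g) (C := 1)
      (by simp) (fun t ht => hg0 t ⟨by linarith [ht.1], by linarith [ht.2]⟩)
    simpa [Real.volume_real_Ioo_of_le hab] using this
  have hqh : ∀ q : ℕ, q ≤ p → (q : ℝ) * h ≤ 1 - 2 * ε := fun q hq => by
    rw [← hph]
    gcongr
  have hmid : (∫ t in ε..1 - ε, g t) =
      ∑ q : Fin p, ∫ t in (ε + q * h)..(ε + q * h) + h, g t := by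
    have := intervalIntegral.sum_integral_adjacent_intervals (f := g) (μ := volume) (n := p)
      (a := fun q : ℕ => ε + q * h) (fun q hq => hii _ _ ?_ ?_)
    · rw [← Fin.sum_univ_eq_sum_range (fun q : ℕ => ∫ t in (ε + q * h)..(ε + (q + 1 : ℕ) * h), g t)]
        at this
      simp only [Nat.cast_zero, zero_mul, add_zero, hph] at this
      rw [show 1 - ε = ε + (1 - 2 * ε) by ring, ← this]
      refine Finset.sum_congr rfl fun q _ => ?_
      congr 1
      push_cast
      ring
    · have := hqh q hq.le
      exact ⟨by positivity, by linarith⟩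
    · have := hqh (q + 1) hq
      exact ⟨by positivity, by linarith⟩
  have hnode : ∀ (q : Fin p) i, ε + q * h + h * z i ∈ Ioo (0 : ℝ) 1 := by
    intro q i
    have h1 := hqh (q + 1) q.2
    push_cast at h1
    have h2 := hz i
    constructor
    · have := h2.1
      positivity
    · nlinarith [h2.2]
  set B : Fin p → ℝ := fun q => ∑ i, w i * g (ε + q * h + h * z i) with hB
  have hB1 : ∀ q, |B q| ≤ 1 := by
    intro q
    calc _ ≤ ∑ i, |w i * g (ε + q * h + h * z i)| := Finset.abs_sum_le_sum_abs _ _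
      _ ≤ ∑ i, w i := Finset.sum_le_sum fun i _ => by
          rw [abs_mul, abs_of_nonneg (hw i)]
          exact mul_le_of_le_one_right (hw i) (hg0 _ (hnode q i))
      _ = 1 := hw1
  have hsum : ∑ q : Fin p, ∑ i, w i / p * g (ε + q * h + h * z i) = ∑ q, B q / p := by
    simp only [hB, Finset.sum_div]
    exact Finset.sum_congr rfl fun q _ => Finset.sum_congr rfl fun i _ => by ring
  have hpanel : ∀ q : Fin p, |(∫ t in (ε + q * h)..(ε + q * h) + h, g t) - B q / p| ≤
      2 * h ^ (n + 1) * h + 2 * ε / p := by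
    intro q
    have h1 := hqh (q + 1) q.2
    push_cast at h1
    have e1 := panel_error hw hw1 hz hex hg hgb (a := ε + q * h) (h := h) (by positivity) hh
      (by linarith)
    have e2 : |B q * (h - 1 / p)| ≤ 2 * ε / p := by
      rw [abs_mul]
      refine (mul_le_of_le_one_left (abs_nonneg _) (hB1 q)).trans (le_of_eq ?_)
      have : h - 1 / p = -(2 * ε / p) := by
        field_simp
        linarith
      rw [this, abs_neg, abs_of_pos (by positivity)]
    calc _ = |((∫ t in (ε + q * h)..(ε + q * h) + h, g t) - h * B q) + B q * (h - 1 / p)| := by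
          congr 1
          ring
      _ ≤ _ := abs_add_le _ _
      _ ≤ _ := add_le_add e1 e2
  have hmain : |∑ q : Fin p, ((∫ t in (ε + q * h)..(ε + q * h) + h, g t) - B q / p)| ≤
      2 * h ^ (n + 1) + 2 * ε := by
    refine (Finset.abs_sum_le_sum_abs _ _).trans ((Finset.sum_le_sum fun q _ => hpanel q).trans ?_)
    rw [Finset.sum_const, Finset.card_univ, Fintype.card_fin, nsmul_eq_mul, mul_add,
      mul_div_cancel₀ _ hp'.ne']
    have : (p : ℝ) * (2 * h ^ (n + 1) * h) = 2 * h ^ (n + 1) * (p * h) := by ring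
    rw [this]
    have : 2 * h ^ (n + 1) * (p * h) ≤ 2 * h ^ (n + 1) :=
      mul_le_of_le_one_right (by positivity) (by linarith)
    linarith
  rw [Finset.sum_sub_distrib, ← hmid, ← hsum] at hmain
  rw [hsplit]
  have e1 := hend 0 ε le_rfl hε.le (by linarith)
  have e2 := hend (1 - ε) 1 (by linarith) (by linarith) le_rfl
  rw [abs_le] at *
  constructor <;> linarith [hmain.1, hmain.2, e1.1, e1.2, e2.1, e2.2]

open Set in
/-- For every `m ≥ 1` there is a positive normalized quadrature rule with `m` nodes in `(0,1)`
whose error on functions with `|g|, |g⁽ᵏ⁾| ≤ 1` is `O(m⁻ᵏ)`. -/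
lemma exists_quadrature_on_Ioo (k : ℕ) (hk : 0 < k) :
    ∃ C : ℝ, 0 < C ∧ ∀ m : ℕ, 0 < m → ∃ x w : Fin m → ℝ,
      (∀ i, x i ∈ Ioo (0 : ℝ) 1) ∧ (∀ i, 0 ≤ w i) ∧ ∑ i, w i = 1 ∧
      ∀ g : ℝ → ℝ, ContDiffOn ℝ k g (Ioo 0 1) → (∀ t ∈ Ioo (0 : ℝ) 1, |g t| ≤ 1) →
        (∀ t ∈ Ioo (0 : ℝ) 1, |iteratedDeriv k g t| ≤ 1) →
        |(∫ t in Ioo (0 : ℝ) 1, g t) - ∑ i, w i * g (x i)| ≤ C / m ^ k := by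
  obtain ⟨n, rfl⟩ : ∃ n, k = n + 1 := ⟨k - 1, by omega⟩
  obtain ⟨N, hN, w, z, hw, hw1, hz, hex⟩ : ∃ N : ℕ, 0 < N ∧ ∃ w z : Fin N → ℝ, (∀ i, 0 ≤ w i) ∧
      ∑ i, w i = 1 ∧ (∀ i, z i ∈ Icc (0 : ℝ) 1) ∧
      ∀ j < n + 1, ∑ i, w i * z i ^ j = ∫ t in (0 : ℝ)..1, t ^ j :=
    ⟨_, Nat.succ_pos _, exists_positive_quadrature (n + 1)⟩
  refine ⟨2 * (2 * N) ^ (n + 1) + 1, by positivity, fun m hm => ?_⟩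
  have hm' : (0 : ℝ) < m := by exact_mod_cast hm
  have hm1 : (1 : ℝ) ≤ m := by exact_mod_cast hm
  rcases lt_or_ge m N with hmN | hmN
  · refine ⟨fun _ => 1 / 2, fun _ => 1 / m, fun _ => by norm_num, fun _ => by positivity, ?_, ?_⟩
    · simp [hm'.ne']
    · intro g _ hg0 _
      have h1 : |∫ t in Ioo (0 : ℝ) 1, g t| ≤ 1 := by
        simpa using norm_setIntegral_le_of_norm_le_const (μ := volume) (s := Ioo (0 : ℝ) 1)
          (f := g) (C := 1) (by simp) hg0
      have h2 : ∑ _i : Fin m, 1 / (m : ℝ) * g (1 / 2) = g (1 / 2) := by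
        simp [hm'.ne']
      have h3 := hg0 (1 / 2) (by norm_num)
      rw [h2, le_div_iff₀ (by positivity)]
      have h4 : (m : ℝ) ^ (n + 1) ≤ (2 * N) ^ (n + 1) := by
        have : (m : ℝ) < N := by exact_mod_cast hmN
        gcongr
        linarith
      calc _ ≤ 2 * (2 * (N : ℝ)) ^ (n + 1) := by
            gcongr
            exact (abs_sub _ _).trans (by linarith)
        _ ≤ _ := by linarith
  · set p := m / N with hpdef
    have hp : 0 < p := Nat.div_pos hmN hN
    have hp' : (0 : ℝ) < p := by exact_mod_cast hp
    have hcard : Fintype.card (Fin p × Fin N) ≤ Fintype.card (Fin m) := by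
      simpa using Nat.div_mul_le_self m N
    obtain ⟨e⟩ := Function.Embedding.nonempty_of_card_le hcard
    set ε : ℝ := 1 / (4 * m ^ (n + 1)) with hεdef
    have hε : 0 < ε := by positivity
    have hε4 : ε ≤ 1 / 4 := by
      rw [hεdef]
      gcongr
      linarith [one_le_pow₀ (n := n + 1) hm1]
    set h : ℝ := (1 - 2 * ε) / p with hhdef
    have hh : 0 < h := div_pos (by linarith) hp'
    have hph : p * h = 1 - 2 * ε := by
      rw [hhdef]
      field_simp
    let X : Fin p × Fin N → ℝ := fun q => ε + q.1 * h + h * z q.2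
    let W : Fin p × Fin N → ℝ := fun q => w q.2 / p
    have hX : ∀ q, X q ∈ Ioo (0 : ℝ) 1 := by
      rintro ⟨q, i⟩
      have h1 : ((q : ℕ) + 1 : ℝ) * h ≤ p * h := by
        gcongr
        exact_mod_cast q.2
      have h2 := hz i
      have := h2.1
      refine ⟨by positivity, ?_⟩
      simp only [X]
      nlinarith [h2.2]
    have hWe : ∀ i ∉ range e, Function.extend e W 0 i = 0 := fun i hi =>
      Function.extend_apply' _ _ _ hi
    refine ⟨Function.extend e X fun _ => 1 / 2, Function.extend e W 0, fun i => ?_, fun i => ?_,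
      ?_, ?_⟩
    · by_cases hi : i ∈ range e
      · obtain ⟨a, rfl⟩ := hi
        simpa only [e.injective.extend_apply] using hX a
      · rw [Function.extend_apply' _ _ _ hi]
        norm_num
    · by_cases hi : i ∈ range e
      · obtain ⟨a, rfl⟩ := hi
        simpa only [e.injective.extend_apply] using div_nonneg (hw a.2) hp'.le
      · exact (hWe i hi).ge
    · rw [← Fintype.sum_of_injective e e.injective W _ hWe
        fun i => (e.injective.extend_apply _ _ i).symm, Fintype.sum_prod_type]
      simp only [W, ← Finset.sum_div, hw1]
      simp [hp'.ne']
    · intro g hg hg0 hgb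
      have hs : ∑ i, Function.extend e W 0 i * g (Function.extend e X (fun _ => 1 / 2) i) =
          ∑ q : Fin p, ∑ i, w i / p * g (ε + q * h + h * z i) := by
        rw [← Fintype.sum_prod_type' (f := fun (q : Fin p) i => w i / p * g (ε + q * h + h * z i))]
        refine (Fintype.sum_of_injective e e.injective _ _ (fun i hi => ?_) fun i => ?_).symm
        · rw [hWe i hi, zero_mul]
        · simp only [e.injective.extend_apply, W, X]
      rw [hs]
      refine (composite_quadrature_error hp hw hw1 hz hex hε hh hph hg hg0 hgb).trans ?_
      have hle : h ≤ 2 * N / m := by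
        have h1 : (m : ℝ) ≤ 2 * N * p := by
          have h2 : m < (p + 1) * N := by
            rw [mul_comm]
            exact Nat.lt_mul_div_succ m hN
          have h3 : m ≤ 2 * N * p := by nlinarith
          exact_mod_cast h3
        rw [hhdef, div_le_div_iff₀ hp' hm']
        nlinarith
      have h5 : h ^ (n + 1) ≤ (2 * N) ^ (n + 1) / m ^ (n + 1) := by
        rw [← div_pow]
        gcongr
      have h6 : 4 * ε = 1 / m ^ (n + 1) := by
        rw [hεdef]
        field_simp
      rw [h6, add_div, mul_div_assoc]
      gcongr

lemma integral_pi_fin_succ {d : ℕ} (μ : Measure ℝ) [IsProbabilityMeasure μ]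
    (f : (Fin (d + 1) → ℝ) → ℝ) :
    ∫ x, f x ∂Measure.pi (fun _ => μ) =
      ∫ q, f (Fin.cons q.1 q.2) ∂μ.prod (Measure.pi fun _ : Fin d => μ) := by
  have h := measurePreserving_piFinSuccAbove (fun _ : Fin (d + 1) => μ) 0
  rw [← h.integral_comp']
  congr 1
  ext x
  congr 1
  exact (Fin.cons_self_tail x).symm

/-- Replacing each factor of a product measure on a function of `d` variables costs at most `d`
times the one-dimensional error. -/
lemma abs_integral_pi_sub_integral_pi_le {μ ν : Measure ℝ} [IsProbabilityMeasure μ]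
    [IsProbabilityMeasure ν] {δ : ℝ} (d : ℕ) (f : (Fin d → ℝ) → ℝ) (hf : Measurable f)
    (hf1 : ∀ x, |f x| ≤ 1)
    (hδ : ∀ x i, |∫ s, f (Function.update x i s) ∂μ - ∫ s, f (Function.update x i s) ∂ν| ≤ δ) :
    |∫ x, f x ∂Measure.pi (fun _ => μ) - ∫ x, f x ∂Measure.pi (fun _ => ν)| ≤ d * δ := by
  induction d with
  | zero =>
    rw [Measure.pi_of_empty (fun _ => μ), Measure.pi_of_empty (fun _ => ν)]
    simp
  | succ d ih =>
    have hcons : Measurable fun q : ℝ × (Fin d → ℝ) => f (Fin.cons q.1 q.2) := by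
      refine hf.comp (measurable_pi_iff.mpr fun i => ?_)
      refine Fin.cases ?_ (fun j => ?_) i
      · simpa using measurable_fst
      · simp only [Fin.cons_succ]
        exact (measurable_pi_apply j).comp measurable_snd
    have hint : ∀ (ρ : Measure (ℝ × (Fin d → ℝ))) [IsProbabilityMeasure ρ],
        Integrable (fun q : ℝ × (Fin d → ℝ) => f (Fin.cons q.1 q.2)) ρ := fun ρ _ =>
      Integrable.of_bound hcons.aestronglyMeasurable 1 (ae_of_all _ fun q => hf1 _)
    rw [integral_pi_fin_succ, integral_pi_fin_succ, integral_prod_symm _ (hint _),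
      integral_prod _ (hint _)]
    have h1 : |(∫ y, ∫ t, f (Fin.cons t y) ∂μ ∂Measure.pi (fun _ : Fin d => μ)) -
        ∫ y, ∫ t, f (Fin.cons t y) ∂ν ∂Measure.pi (fun _ : Fin d => μ)| ≤ δ := by
      rw [← integral_sub (hint _).integral_prod_right (hint _).integral_prod_right]
      have := norm_integral_le_of_norm_le_const (μ := Measure.pi (fun _ : Fin d => μ))
        (f := fun y => (∫ t, f (Fin.cons t y) ∂μ) - ∫ t, f (Fin.cons t y) ∂ν) (C := δ)
        (ae_of_all _ fun y => by
          simpa only [Fin.update_cons_zero, Real.norm_eq_abs] using hδ (Fin.cons 0 y) 0)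
      simpa using this
    have h2 : |(∫ t, ∫ y, f (Fin.cons t y) ∂Measure.pi (fun _ : Fin d => μ) ∂ν) -
        ∫ t, ∫ y, f (Fin.cons t y) ∂Measure.pi (fun _ : Fin d => ν) ∂ν| ≤ d * δ := by
      rw [← integral_sub (hint _).integral_prod_left (hint _).integral_prod_left]
      have := norm_integral_le_of_norm_le_const (μ := ν)
        (f := fun t => (∫ y, f (Fin.cons t y) ∂Measure.pi (fun _ : Fin d => μ)) -
          ∫ y, f (Fin.cons t y) ∂Measure.pi (fun _ : Fin d => ν)) (C := d * δ)
        (ae_of_all _ fun t => by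
          refine ih (fun y => f (Fin.cons t y)) (hcons.comp measurable_prodMk_left)
            (fun _ => hf1 _) fun y i => ?_
          simpa only [Fin.cons_update] using hδ (Fin.cons t y) i.succ)
      simpa using this
    rw [integral_integral_swap (hint (ν.prod (Measure.pi fun _ : Fin d => μ)))] at h2
    push_cast
    rw [abs_le] at *
    constructor <;> linarith [h1.1, h1.2, h2.1, h2.2]

lemma mderiv_single {d : ℕ} (i : Fin d) (k : ℕ) (f : (Fin d → ℝ) → ℝ) :
    mderiv d (Pi.single i k) f = (pderiv' d i)^[k] f := by
  have h : ((List.finRange d).flatMap fun j => List.replicate ((Pi.single i k : Fin d → ℕ) j) j) =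
      List.replicate k i := by
    have key : ∀ l : List (Fin d), l.Nodup →
        (l.flatMap fun j => List.replicate ((Pi.single i k : Fin d → ℕ) j) j) =
          if i ∈ l then List.replicate k i else [] := by
      intro l
      induction l with
      | nil => simp
      | cons a l ih =>
        intro hl
        rw [List.nodup_cons] at hl
        rw [List.flatMap_cons, ih hl.2]
        by_cases ha : a = i
        · subst ha
          simp [hl.1]
        · simp [ha, Ne.symm ha]
    rw [key _ (List.nodup_finRange d), if_pos (List.mem_finRange i)]
  rw [mderiv, h]
  clear h
  induction k with
  | zero => rfl
  | succ k ih => rw [List.replicate_succ, List.foldr_cons, ih, Function.iterate_succ_apply']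

/-- Iterated derivatives along a coordinate line are iterated partial derivatives. -/
lemma section_contDiffOn_and_iteratedDeriv {d : ℕ} {D : Set (Fin d → ℝ)} (hD : IsOpen D)
    (x : Fin d → ℝ) (i : Fin d) {S : Set ℝ} (hS : IsOpen S)
    (hSD : ∀ s ∈ S, Function.update x i s ∈ D) (k : ℕ) (f : (Fin d → ℝ) → ℝ)
    (hf : ContDiffOn ℝ k f D) :
    ContDiffOn ℝ k (fun s => f (Function.update x i s)) S ∧
      ∀ s ∈ S, iteratedDeriv k (fun s => f (Function.update x i s)) s =
        (pderiv' d i)^[k] f (Function.update x i s) := by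
  refine ⟨hf.comp (contDiff_update _ x i).contDiffOn hSD, ?_⟩
  induction k generalizing f with
  | zero => simp
  | succ k ih =>
    intro s hs
    have hderiv : Set.EqOn (deriv fun s => f (Function.update x i s))
        (fun s => pderiv' d i f (Function.update x i s)) S := by
      intro t ht
      have h1 : DifferentiableAt ℝ f (Function.update x i t) :=
        (hf.contDiffAt (hD.mem_nhds (hSD t ht))).differentiableAt (by simp)
      exact (h1.hasFDerivAt.comp_hasDerivAt t (hasDerivAt_update x i t)).deriv
    rw [iteratedDeriv_succ', hderiv.iteratedDeriv_of_isOpen hS k hs, Function.iterate_succ_apply]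
    refine ih _ ?_ s hs
    exact (hf.fderiv_of_isOpen hD (by norm_cast)).clm_apply contDiffOn_const

lemma isOpen_unitCube (d : ℕ) : IsOpen (unitCube d) :=
  isOpen_set_pi Set.finite_univ fun _ _ => isOpen_Ioo

lemma abs_le_one_of_mem_Fkd {k d : ℕ} {D : Set (Fin d → ℝ)} {f : (Fin d → ℝ) → ℝ}
    (hf : f ∈ Fkd k d D) {x : Fin d → ℝ} (hx : x ∈ D) : |f x| ≤ 1 := by
  have h : ((List.finRange d).flatMap fun i => List.replicate ((0 : Fin d → ℕ) i) i) = [] :=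
    List.flatMap_eq_nil_iff.mpr fun _ _ => rfl
  have h1 := hf.2 0 (by simp) x hx
  rwa [mderiv, h] at h1

open Set in
/-- Error of the product rule on `F^k_d`: a function vanishing on the product grid has integral at
most `d` times the univariate error. -/
lemma abs_setIntegral_unitCube_le {k d m : ℕ} {δ : ℝ} (hδ0 : 0 ≤ δ) {x w : Fin m → ℝ}
    (hx : ∀ i, x i ∈ Ioo (0 : ℝ) 1) (hw : ∀ i, 0 ≤ w i) (hw1 : ∑ i, w i = 1)
    (hQ : ∀ g : ℝ → ℝ, ContDiffOn ℝ k g (Ioo 0 1) → (∀ t ∈ Ioo (0 : ℝ) 1, |g t| ≤ 1) →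
      (∀ t ∈ Ioo (0 : ℝ) 1, |iteratedDeriv k g t| ≤ 1) →
      |(∫ t in Ioo (0 : ℝ) 1, g t) - ∑ i, w i * g (x i)| ≤ δ)
    {f : (Fin d → ℝ) → ℝ} (hf : f ∈ Fkd k d (unitCube d))
    (hf0 : ∀ a : Fin d → Fin m, f (fun j => x (a j)) = 0) :
    |∫ t in unitCube d, f t| ≤ d * δ := by
  set μ : Measure ℝ := volume.restrict (Ioo 0 1) with hμ
  set ν : Measure ℝ := ∑ i, ENNReal.ofReal (w i) • Measure.dirac (x i) with hν
  have hμp : IsProbabilityMeasure μ := ⟨by simp [hμ]⟩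
  have hνp : IsProbabilityMeasure ν := by
    refine ⟨?_⟩
    simp only [hν, Measure.coe_finsetSum, Finset.sum_apply, Measure.smul_apply, measure_univ,
      smul_eq_mul, mul_one]
    rw [← ENNReal.ofReal_sum_of_nonneg fun i _ => hw i, hw1, ENNReal.ofReal_one]
  have hνint : ∀ g : ℝ → ℝ, ∫ t, g t ∂ν = ∑ i, w i * g (x i) := by
    intro g
    rw [hν, integral_finsetSum_measure fun i _ =>
      (integrable_dirac (by simp)).smul_measure ENNReal.ofReal_ne_top]
    simp [integral_smul_measure, ENNReal.toReal_ofReal, hw]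
  have hνrange : ∀ᵐ t ∂ν, t ∈ range x := by
    rw [ae_iff, hν]
    simp only [Measure.coe_finsetSum, Finset.sum_apply, Measure.smul_apply, smul_eq_mul]
    refine Finset.sum_eq_zero fun i _ => ?_
    have hset : MeasurableSet {t | t ∉ range x} := (finite_range x).measurableSet.compl
    rw [Measure.dirac_apply' _ hset]
    simp
  have hmeas : MeasurableSet (unitCube d) := (isOpen_unitCube d).measurableSet
  set F : (Fin d → ℝ) → ℝ := (unitCube d).indicator f with hF
  have hFmeas : Measurable F := by
    classical
    rw [hF, ← piecewise_eq_indicator]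
    exact hf.1.continuousOn.measurable_piecewise continuousOn_const hmeas
  have hF1 : ∀ y, |F y| ≤ 1 := by
    intro y
    by_cases hy : y ∈ unitCube d
    · rw [hF, indicator_of_mem hy]
      exact abs_le_one_of_mem_Fkd hf hy
    · simp [hF, hy]
  have hsec : ∀ y i, |∫ s, F (Function.update y i s) ∂μ - ∫ s, F (Function.update y i s) ∂ν| ≤ δ := by
    intro y i
    by_cases hy : ∀ j ≠ i, y j ∈ Ioo (0 : ℝ) 1
    · have hS : ∀ s ∈ Ioo (0 : ℝ) 1, Function.update y i s ∈ unitCube d := by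
        intro s hs j _
        by_cases hj : j = i
        · subst hj
          simpa using hs
        · simpa [hj] using hy j hj
      have heq : EqOn (fun s => F (Function.update y i s)) (fun s => f (Function.update y i s))
          (Ioo 0 1) := fun s hs => indicator_of_mem (hS s hs) f
      obtain ⟨h1, h2⟩ := section_contDiffOn_and_iteratedDeriv (isOpen_unitCube d) y i isOpen_Ioo hS
        k f hf.1
      rw [hνint]
      refine hQ (fun s => F (Function.update y i s)) (h1.congr heq) (fun _ _ => hF1 _) fun t ht => ?_
      rw [heq.iteratedDeriv_of_isOpen isOpen_Ioo k ht, h2 t ht, ← mderiv_single]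
      exact hf.2 _ (by simp) _ (hS t ht)
    · push Not at hy
      obtain ⟨j, hj, hyj⟩ := hy
      have hz : ∀ s, F (Function.update y i s) = 0 := by
        intro s
        refine indicator_of_notMem (fun h => hyj ?_) f
        simpa [hj] using h j (mem_univ j)
      simpa [hz] using hδ0
  have hpi := abs_integral_pi_sub_integral_pi_le d F hFmeas hF1 hsec
  have hνzero : ∫ y, F y ∂Measure.pi (fun _ => ν) = 0 := by
    refine integral_eq_zero_of_ae ?_
    have hall : ∀ᵐ y ∂Measure.pi (fun _ : Fin d => ν), ∀ j, y j ∈ range x :=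
      ae_all_iff.mpr fun j => Measure.tendsto_eval_ae_ae (i := j) hνrange
    filter_upwards [hall] with y hy
    choose a ha using hy
    have hya : y = fun j => x (a j) := funext fun j => (ha j).symm
    rw [hF, indicator_of_mem, hya, hf0, Pi.zero_apply]
    rw [hya]
    exact fun j _ => hx (a j)
  have hμpi : ∫ y, F y ∂Measure.pi (fun _ => μ) = ∫ t in unitCube d, f t := by
    rw [hμ, ← Measure.restrict_pi_pi, ← volume_pi]
    exact setIntegral_congr_fun hmeas fun y hy => indicator_of_mem hy f
  rwa [hνzero, hμpi, sub_zero] at hpi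

/-- For every `k` there is `c_{k,2} > 0` with
`e(n, F^k_d) ≤ min(1, c_{k,2} · d · n^{-k/d})` for all `d, m ≥ 1` and `n = m^d`. -/
theorem upper_bound_Fkd (k : ℕ) (hk : 0 < k) :
    ∃ c : ℝ, 0 < c ∧ ∀ d m : ℕ, 0 < d → 0 < m →
      interr (unitCube d) (Fkd k d (unitCube d)) (m ^ d) ≤
        min 1 (c * d * ((m ^ d : ℕ) : ℝ) ^ (-(k : ℝ) / d)) := by
  obtain ⟨C, hC, hrule⟩ := exists_quadrature_on_Ioo k hk
  refine ⟨C, hC, fun d m hd hm => ?_⟩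
  obtain ⟨x, w, hx, hw, hw1, hQ⟩ := hrule m hm
  have hd' : (d : ℝ) ≠ 0 := by exact_mod_cast hd.ne'
  have hpow : ((m ^ d : ℕ) : ℝ) ^ (-(k : ℝ) / d) = 1 / (m : ℝ) ^ k := by
    rw [Nat.cast_pow, ← Real.rpow_natCast_mul m.cast_nonneg, mul_div_cancel₀ _ hd',
      Real.rpow_neg m.cast_nonneg, Real.rpow_natCast, one_div]
  rw [hpow]
  have hnonneg : 0 ≤ min 1 (C * d * (1 / (m : ℝ) ^ k)) := le_min zero_le_one (by positivity)
  let X : Fin (m ^ d) → unitCube d := fun a =>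
    ⟨fun j => x (finFunctionFinEquiv.symm a j), fun j _ => hx _⟩
  rw [interr]
  by_cases hbdd : BddBelow (Set.range fun x : Fin (m ^ d) → unitCube d =>
      sSup ((fun f => ∫ t in unitCube d, f t) ''
        {f | f ∈ Fkd k d (unitCube d) ∧ ∀ i, f (x i : Fin d → ℝ) = 0}))
  · refine (ciInf_le hbdd X).trans (Real.sSup_le ?_ hnonneg)
    rintro _ ⟨f, ⟨hf, hf0⟩, rfl⟩
    refine le_min ?_ ?_
    · have hvol : volume (unitCube d) = 1 := by simp [unitCube, Real.volume_pi_Ioo]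
      have := norm_setIntegral_le_of_norm_le_const (μ := volume) (s := unitCube d) (f := f) (C := 1)
        (by simp [hvol]) fun t ht => abs_le_one_of_mem_Fkd hf ht
      refine (le_abs_self _).trans (this.trans ?_)
      simp [Measure.real, hvol]
    · refine (le_abs_self _).trans ((abs_setIntegral_unitCube_le (δ := C / m ^ k) (by positivity)
        hx hw hw1 hQ hf fun a => ?_).trans (le_of_eq (by ring)))
      simpa [X] using hf0 (finFunctionFinEquiv a)
  · rw [Real.iInf_of_not_bddBelow hbdd]
    exact hnonneg
end

section
/- Let d ∈ ℕ and let D ⊂ ℝ^d be an open set with Lebesgue measure λ^d(D) = 1. Then for every ε ∈ (0, d/(d+2)), the information complexity of integration on F²_d(D) satisfies n(ε, F²_d(D)) ≥ (2/(2+d)) · ( (1/533) · (d/(d+2)) · (d/ε) )^{d/2}. -/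
open MeasureTheory

open Set Filter Topology

/-- The squared Euclidean norm on `ℝ^d`. -/
def sqNorm {d : ℕ} (x : Fin d → ℝ) : ℝ := ∑ i, x i ^ 2

section SqNorm

variable {d : ℕ}

lemma sqNorm_nonneg (x : Fin d → ℝ) : 0 ≤ sqNorm x :=
  Finset.sum_nonneg fun _ _ => sq_nonneg _

@[simp] lemma sqNorm_zero : sqNorm (0 : Fin d → ℝ) = 0 := by simp [sqNorm]

lemma continuous_sqNorm : Continuous (sqNorm : (Fin d → ℝ) → ℝ) := by
  unfold sqNorm; fun_prop

lemma sqNorm_smul (t : ℝ) (x : Fin d → ℝ) : sqNorm (t • x) = t ^ 2 * sqNorm x := by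
  simp [sqNorm, Finset.mul_sum, mul_pow]

lemma sqNorm_sub_comm (x y : Fin d → ℝ) : sqNorm (x - y) = sqNorm (y - x) := by
  simp only [sqNorm, Pi.sub_apply]
  exact Finset.sum_congr rfl fun i _ => by ring

lemma sqNorm_single (i : Fin d) : sqNorm (Pi.single i (1 : ℝ)) = 1 := by
  simp [sqNorm, Pi.single_apply]

lemma sqNorm_add_add_sqNorm_sub (u v : Fin d → ℝ) :
    sqNorm (u + v) + sqNorm (u - v) = 2 * sqNorm u + 2 * sqNorm v := by
  simp only [sqNorm, Finset.mul_sum, ← Finset.sum_add_distrib, Pi.add_apply, Pi.sub_apply]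
  exact Finset.sum_congr rfl fun i _ => by ring

lemma sqNorm_add_le (u v : Fin d → ℝ) : sqNorm (u + v) ≤ 2 * sqNorm u + 2 * sqNorm v := by
  linarith [sqNorm_add_add_sqNorm_sub u v, sqNorm_nonneg (u - v)]

lemma sqNorm_sub_le (x y z : Fin d → ℝ) :
    sqNorm (x - z) ≤ 2 * sqNorm (x - y) + 2 * sqNorm (y - z) := by
  simpa using sqNorm_add_le (x - y) (y - z)

end SqNorm

/-- The infimal convolution of `u` with `|·|² / 4`. -/
noncomputable def infConv {d : ℕ} (u : (Fin d → ℝ) → ℝ) (x : Fin d → ℝ) : ℝ :=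
  ⨅ y, (u y + sqNorm (x - y) / 4)

/-- The supremal convolution of `u` with `-|·|² / 2`. -/
noncomputable def supConv {d : ℕ} (u : (Fin d → ℝ) → ℝ) (x : Fin d → ℝ) : ℝ :=
  ⨆ y, (u y - sqNorm (x - y) / 2)

section Envelopes

variable {d : ℕ} {u : (Fin d → ℝ) → ℝ} {h : ℝ}

lemma infConv_le (hu : ∀ y, 0 ≤ u y) (x y : Fin d → ℝ) :
    infConv u x ≤ u y + sqNorm (x - y) / 4 :=
  ciInf_le ⟨0, by rintro _ ⟨z, rfl⟩; have := sqNorm_nonneg (x - z); have := hu z; positivity⟩ y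

lemma le_infConv {x : Fin d → ℝ} {c : ℝ} (hc : ∀ y, c ≤ u y + sqNorm (x - y) / 4) :
    c ≤ infConv u x :=
  le_ciInf hc

lemma infConv_nonneg (hu : ∀ y, 0 ≤ u y) (x : Fin d → ℝ) : 0 ≤ infConv u x :=
  le_infConv fun y => by have := sqNorm_nonneg (x - y); have := hu y; positivity

lemma infConv_le_self (hu : ∀ y, 0 ≤ u y) (x : Fin d → ℝ) : infConv u x ≤ u x := by
  simpa using infConv_le hu x x

/-- The infimal convolution is semiconcave. -/
lemma infConv_add_infConv_le (hu : ∀ y, 0 ≤ u y) (x w : Fin d → ℝ) :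
    infConv u (x + w) + infConv u (x - w) ≤ 2 * infConv u x + sqNorm w / 2 := by
  have key : (infConv u (x + w) + infConv u (x - w) - sqNorm w / 2) / 2 ≤ infConv u x := by
    refine le_infConv fun y => ?_
    have h1 := infConv_le hu (x + w) y
    have h2 := infConv_le hu (x - w) y
    have h3 := sqNorm_add_add_sqNorm_sub (x - y) w
    rw [show x - y + w = x + w - y by abel, show x - y - w = x - w - y by abel] at h3
    linarith
  linarith

lemma le_supConv (hu : ∀ y, u y ≤ h) (x y : Fin d → ℝ) :
    u y - sqNorm (x - y) / 2 ≤ supConv u x :=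
  le_ciSup (f := fun y => u y - sqNorm (x - y) / 2)
    ⟨h, by rintro _ ⟨z, rfl⟩; have := sqNorm_nonneg (x - z); have := hu z; dsimp only; linarith⟩ y

lemma supConv_le {x : Fin d → ℝ} {c : ℝ} (hc : ∀ y, u y - sqNorm (x - y) / 2 ≤ c) :
    supConv u x ≤ c :=
  ciSup_le hc

lemma self_le_supConv (hu : ∀ y, u y ≤ h) (x : Fin d → ℝ) : u x ≤ supConv u x := by
  simpa using le_supConv hu x x

lemma supConv_le_of_le (hu : ∀ y, u y ≤ h) (x : Fin d → ℝ) : supConv u x ≤ h :=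
  supConv_le fun y => by linarith [sqNorm_nonneg (x - y), hu y]

lemma measurable_supConv (hu : ∀ y, u y ≤ h) : Measurable (supConv u) := by
  refine LowerSemicontinuous.measurable ?_
  refine lowerSemicontinuous_ciSup (f := fun y x => u y - sqNorm (x - y) / 2) (fun x => ?_)
    fun y => Continuous.lowerSemicontinuous ?_
  · exact ⟨h, by rintro _ ⟨z, rfl⟩; linarith [sqNorm_nonneg (x - z), hu z]⟩
  · exact continuous_const.sub
      ((continuous_sqNorm.comp (continuous_id.sub continuous_const)).div_const 2)

/-- The supremal convolution is semiconvex. -/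
lemma le_supConv_add_supConv (hu : ∀ y, u y ≤ h) (x v : Fin d → ℝ) :
    2 * supConv u x - sqNorm v ≤ supConv u (x + v) + supConv u (x - v) := by
  have key : supConv u x ≤ (supConv u (x + v) + supConv u (x - v) + sqNorm v) / 2 := by
    refine supConv_le fun y => ?_
    have h1 := le_supConv hu (x + v) y
    have h2 := le_supConv hu (x - v) y
    have h3 := sqNorm_add_add_sqNorm_sub (x - y) v
    rw [show x - y + v = x + v - y by abel, show x - y - v = x - v - y by abel] at h3
    linarith
  linarith

/-- The supremal convolution preserves semiconcavity, with a worse constant. -/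
lemma supConv_add_supConv_le (hu : ∀ y, u y ≤ h)
    (hconc : ∀ x w, u (x + w) + u (x - w) ≤ 2 * u x + sqNorm w / 2) (x v : Fin d → ℝ) :
    supConv u (x + v) + supConv u (x - v) ≤ 2 * supConv u x + sqNorm v := by
  have key (a b : Fin d → ℝ) : (u a - sqNorm (x + v - a) / 2) + (u b - sqNorm (x - v - b) / 2)
      ≤ 2 * supConv u x + sqNorm v := by
    have h1 := hconc ((1 / 2 : ℝ) • (a + b)) ((1 / 2 : ℝ) • (a - b))
    have h2 := le_supConv hu x ((1 / 2 : ℝ) • (a + b))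
    have h3 : sqNorm ((1 / 2 : ℝ) • (a - b)) / 2 + sqNorm (x - (1 / 2 : ℝ) • (a + b))
        ≤ sqNorm v + sqNorm (x + v - a) / 2 + sqNorm (x - v - b) / 2 := by
      simp only [sqNorm, Finset.sum_div, ← Finset.sum_add_distrib, Pi.add_apply, Pi.sub_apply,
        Pi.smul_apply, smul_eq_mul]
      refine Finset.sum_le_sum fun i _ => ?_
      nlinarith [sq_nonneg ((a i - b i) / 2 - 2 * v i)]
    rw [show (1 / 2 : ℝ) • (a + b) + (1 / 2 : ℝ) • (a - b) = a by
        ext i; simp; ring,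
      show (1 / 2 : ℝ) • (a + b) - (1 / 2 : ℝ) • (a - b) = b by
        ext i; simp; ring] at h1
    linarith
  have h4 : supConv u (x + v) ≤ 2 * supConv u x + sqNorm v - supConv u (x - v) := by
    refine supConv_le fun a => ?_
    have h5 : supConv u (x - v) ≤
        2 * supConv u x + sqNorm v - (u a - sqNorm (x + v - a) / 2) :=
      supConv_le fun b => by linarith [key a b]
    linarith
  linarith

end Envelopes

section Fooling

variable {d : ℕ}

/-- A function with bounded second differences that vanishes near `S` and equals `h` far from
`S`. -/
lemma exists_semiconvex_semiconcave (S : Set (Fin d → ℝ)) {h : ℝ} (hh : 0 ≤ h) :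
    ∃ k : (Fin d → ℝ) → ℝ, Measurable k ∧ (∀ x, 0 ≤ k x) ∧ (∀ x, k x ≤ h) ∧
      (∀ x v, |k (x + v) + k (x - v) - 2 * k x| ≤ sqNorm v) ∧
      (∀ x ∈ S, k x = 0) ∧ (∀ x, (∀ y ∈ S, 4 * h ≤ sqNorm (x - y)) → k x = h) := by
  classical
  set u : (Fin d → ℝ) → ℝ := fun y => if y ∈ S then 0 else h with hu
  have hu0 : ∀ y, 0 ≤ u y := fun y => by simp only [hu]; split_ifs <;> simp [hh]
  have huh : ∀ y, u y ≤ h := fun y => by simp only [hu]; split_ifs <;> simp [hh]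
  have hgh : ∀ y, infConv u y ≤ h := fun y => (infConv_le_self hu0 y).trans (huh y)
  have hk0 : ∀ x, 0 ≤ supConv (infConv u) x := fun x =>
    (infConv_nonneg hu0 x).trans (self_le_supConv hgh x)
  refine ⟨supConv (infConv u), measurable_supConv hgh, hk0, supConv_le_of_le hgh, fun x v => ?_,
    fun x hx => le_antisymm (supConv_le fun y => ?_) (hk0 x), fun x hx =>
    le_antisymm (supConv_le_of_le hgh x) ((le_infConv fun y => ?_).trans (self_le_supConv hgh x))⟩
  · rw [abs_le]
    constructor
    · linarith [le_supConv_add_supConv hgh x v]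
    · linarith [supConv_add_supConv_le hgh (infConv_add_infConv_le hu0) x v]
  · have h1 := infConv_le hu0 y x
    have h2 : u x = 0 := by simp [hu, hx]
    rw [h2, sqNorm_sub_comm] at h1
    linarith [sqNorm_nonneg (x - y)]
  · by_cases hy : y ∈ S
    · have := hx y hy
      linarith [hu0 y]
    · have : u y = h := by simp [hu, hy]
      linarith [sqNorm_nonneg (x - y)]

end Fooling

section Mollification

variable {d : ℕ}

/-- A bounded function with bounded second differences can be smoothed at a given scale `δ`. -/
lemma exists_contDiff_mollification {k : (Fin d → ℝ) → ℝ} {h δ : ℝ} (hδ : 0 < δ)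
    (hkm : Measurable k) (hk0 : ∀ x, 0 ≤ k x) (hkh : ∀ x, k x ≤ h)
    (hk2 : ∀ x v, |k (x + v) + k (x - v) - 2 * k x| ≤ sqNorm v) :
    ∃ f : (Fin d → ℝ) → ℝ, ContDiff ℝ 2 f ∧ (∀ x, 0 ≤ f x) ∧ (∀ x, f x ≤ h) ∧
      (∀ x v, |f (x + v) + f (x - v) - 2 * f x| ≤ sqNorm v) ∧
      (∀ x c, (∀ y ∈ Metric.ball x δ, k y = c) → f x = c) := by
  let φ : ContDiffBump (0 : Fin d → ℝ) := ⟨δ / 2, δ, half_pos hδ, half_lt_self hδ⟩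
  set ψ := φ.normed volume with hψ
  have hψ0 : ∀ z, 0 ≤ ψ z := φ.nonneg_normed
  have hψi : Integrable ψ := φ.integrable_normed
  have hψ1 : ∫ z, ψ z = 1 := φ.integral_normed
  set f : (Fin d → ℝ) → ℝ :=
    convolution ψ k (ContinuousLinearMap.lsmul ℝ ℝ) volume with hf
  have hfx : ∀ x, f x = ∫ z, ψ z * k (x - z) := fun x => by
    simp [hf, convolution_def]
  have habs : ∀ x, ‖k x‖ ≤ h := fun x => by
    rw [Real.norm_eq_abs, abs_of_nonneg (hk0 x)]; exact hkh x
  have hint : ∀ x, Integrable fun z => ψ z * k (x - z) := fun x =>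
    hψi.mul_bdd (c := h) (hkm.comp (measurable_const.sub measurable_id)).aestronglyMeasurable
      (Eventually.of_forall fun z => habs _)
  have hkl : LocallyIntegrable k := by
    refine (locallyIntegrable_const h).mono hkm.aestronglyMeasurable
      (Eventually.of_forall fun x => ?_)
    exact (habs x).trans (le_abs_self h)
  refine ⟨f, ?_, fun x => ?_, fun x => ?_, fun x v => ?_, fun x c hx => ?_⟩
  · exact φ.hasCompactSupport_normed.contDiff_convolution_left (n := 2) _ φ.contDiff_normed hkl
  · rw [hfx]
    exact integral_nonneg fun z => mul_nonneg (hψ0 z) (hk0 _)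
  · calc f x = ∫ z, ψ z * k (x - z) := hfx x
      _ ≤ ∫ z, ψ z * h := integral_mono (hint x) (hψi.mul_const h)
          fun z => mul_le_mul_of_nonneg_left (hkh _) (hψ0 z)
      _ = h := by rw [integral_mul_const, hψ1, one_mul]
  · have hsum : f (x + v) + f (x - v) - 2 * f x
        = ∫ z, ψ z * (k (x - z + v) + k (x - z - v) - 2 * k (x - z)) := by
      rw [hfx, hfx, hfx, ← integral_const_mul, ← integral_add (hint _) (hint _),
        ← integral_sub (by exact (hint _).add (hint _)) ((hint _).const_mul 2)]
      refine integral_congr_ae (Eventually.of_forall fun z => ?_)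
      simp only [show x + v - z = x - z + v by abel, show x - v - z = x - z - v by abel]
      ring
    rw [hsum, ← Real.norm_eq_abs]
    calc ‖∫ z, ψ z * (k (x - z + v) + k (x - z - v) - 2 * k (x - z))‖
        ≤ ∫ z, ψ z * sqNorm v := by
          refine norm_integral_le_of_norm_le (hψi.mul_const _) (Eventually.of_forall fun z => ?_)
          rw [norm_mul, Real.norm_of_nonneg (hψ0 z)]
          exact mul_le_mul_of_nonneg_left (hk2 _ _) (hψ0 z)
      _ = sqNorm v := by rw [integral_mul_const, hψ1, one_mul]
  · have hxx : k x = c := hx x (Metric.mem_ball_self hδ)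
    have := φ.normed_convolution_eq_right (μ := volume) (g := k) (x₀ := x)
      fun y hy => (hx y hy).trans hxx.symm
    exact this.trans hxx

end Mollification

section Derivatives

/-- A twice continuously differentiable function whose even part is maximal at the origin up to
`c t²` has second derivative at most `c` there. -/
lemma deriv_deriv_le_of_second_difference_le {φ : ℝ → ℝ} (hφ : ContDiff ℝ 2 φ) {c : ℝ}
    (hc : ∀ t, φ t + φ (-t) - 2 * φ 0 ≤ c * t ^ 2) : deriv (deriv φ) 0 ≤ c := by
  by_contra! hlt
  have hd : Differentiable ℝ φ := hφ.differentiable (by norm_num)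
  have hd' : Differentiable ℝ (deriv φ) :=
    ((contDiff_succ_iff_deriv (n := 1)).1 hφ).2.2.differentiable (by norm_num)
  set ψ : ℝ → ℝ := fun t => φ t + φ (-t) - c * t ^ 2 with hψ
  have h1 : ∀ t, HasDerivAt ψ (deriv φ t - deriv φ (-t) - 2 * c * t) t := fun t => by
    have := (((hd t).hasDerivAt.add ((hd (-t)).hasDerivAt.comp t (hasDerivAt_neg t))).sub
      ((hasDerivAt_pow 2 t).const_mul c))
    refine this.congr_deriv ?_
    simp; ring
  have h1' : deriv ψ = fun t => deriv φ t - deriv φ (-t) - 2 * c * t := funext fun t => (h1 t).deriv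
  have h2 : HasDerivAt (deriv ψ) (2 * deriv (deriv φ) 0 - 2 * c) 0 := by
    rw [h1']
    have := (((hd' 0).hasDerivAt.sub
      (HasDerivAt.comp (0 : ℝ) (hd' (-0)).hasDerivAt (hasDerivAt_neg 0))).sub
      ((hasDerivAt_id (0 : ℝ)).const_mul (2 * c)))
    refine this.congr_deriv ?_
    simp; ring
  have hmin : IsLocalMin ψ 0 := by
    refine isLocalMin_of_deriv_deriv_pos ?_ ?_ (h1 0).continuousAt
    · rw [h2.deriv]; linarith
    · rw [h1']; simp
  have hconst : ψ =ᶠ[𝓝 0] fun _ => ψ 0 := by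
    filter_upwards [hmin] with t ht
    refine le_antisymm ?_ ht
    have := hc t
    simp only [hψ, neg_zero]
    linarith
  have h3 : deriv (deriv ψ) 0 = 0 := by
    rw [hconst.deriv.deriv_eq]; simp
  rw [h2.deriv] at h3
  linarith

/-- A Landau-type inequality. -/
lemma deriv_le_one_of_abs_deriv_deriv_le {φ : ℝ → ℝ} (hφ : ContDiff ℝ 2 φ) (h0 : ∀ t, 0 ≤ φ t)
    (h1 : ∀ t, φ t ≤ 1) (h2 : ∀ t, |deriv (deriv φ) t| ≤ 1) : deriv φ 0 ≤ 1 := by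
  have hd : Differentiable ℝ φ := hφ.differentiable (by norm_num)
  have hd' : Differentiable ℝ (deriv φ) :=
    ((contDiff_succ_iff_deriv (n := 1)).1 hφ).2.2.differentiable (by norm_num)
  have hlip : ∀ t, |deriv φ t - deriv φ 0| ≤ |t| := fun t => by
    have := Convex.norm_image_sub_le_of_norm_deriv_le (f := deriv φ) (C := 1) (s := Set.univ)
      (x := 0) (y := t) (fun x _ => hd' x) (fun x _ => h2 x) convex_univ trivial trivial
    simpa using this
  set A : ℝ → ℝ := fun t => φ t - φ (-t) - 2 * t * deriv φ 0 + t ^ 2 with hA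
  have hAd : ∀ t, HasDerivAt A (deriv φ t + deriv φ (-t) - 2 * deriv φ 0 + 2 * t) t := fun t => by
    have := (((hd t).hasDerivAt.sub ((hd (-t)).hasDerivAt.comp t (hasDerivAt_neg t))).sub
      (((hasDerivAt_id t).const_mul 2).mul_const (deriv φ 0))).add (hasDerivAt_pow 2 t)
    refine this.congr_deriv ?_
    simp
  have hmono : MonotoneOn A (Set.Ici 0) := by
    refine monotoneOn_of_deriv_nonneg (convex_Ici 0)
      (fun t _ => (hAd t).continuousAt.continuousWithinAt)
      (fun t _ => (hAd t).differentiableAt.differentiableWithinAt) fun t ht => ?_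
    rw [interior_Ici] at ht
    have ht : 0 < t := ht
    have ha := hlip t
    have hb := hlip (-t)
    rw [abs_neg, abs_of_pos ht, abs_le] at hb
    rw [abs_of_pos ht, abs_le] at ha
    rw [(hAd t).deriv]
    linarith [ha.1, hb.1]
  have := hmono (Set.mem_Ici.2 le_rfl) (Set.mem_Ici.2 zero_le_one) zero_le_one
  simp only [hA] at this
  norm_num at this
  linarith [h0 (-1), h1 1]

variable {d : ℕ}

lemma hasDerivAt_comp_line {E : Type*} [NormedAddCommGroup E] [NormedSpace ℝ E] {f : E → ℝ}
    (hf : Differentiable ℝ f) (x v : E) (t : ℝ) :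
    HasDerivAt (fun t : ℝ => f (x + t • v)) (fderiv ℝ f (x + t • v) v) t := by
  have h : HasDerivAt (fun t : ℝ => x + t • v) v t := by
    simpa using ((hasDerivAt_id t).smul_const v).const_add x
  exact (hf _).hasFDerivAt.comp_hasDerivAt t h

lemma abs_fderiv_fderiv_diag_le {f : (Fin d → ℝ) → ℝ} (hf : ContDiff ℝ 2 f)
    (h2 : ∀ x v, |f (x + v) + f (x - v) - 2 * f x| ≤ sqNorm v) (x v : Fin d → ℝ) :
    |fderiv ℝ (fderiv ℝ f) x v v| ≤ sqNorm v := by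
  have hd : Differentiable ℝ f := hf.differentiable (by norm_num)
  have hd' : Differentiable ℝ (fderiv ℝ f) :=
    (hf.fderiv_right (m := 1) (by norm_num)).differentiable (by norm_num)
  have hline : ContDiff ℝ 2 fun t : ℝ => f (x + t • v) := by fun_prop
  have e1 : deriv (fun t : ℝ => f (x + t • v)) = fun t => fderiv ℝ f (x + t • v) v :=
    funext fun t => (hasDerivAt_comp_line hd x v t).deriv
  have e2 : deriv (deriv fun t : ℝ => f (x + t • v)) 0 = fderiv ℝ (fderiv ℝ f) x v v := by
    rw [e1]
    have h := hasDerivAt_comp_line (f := fun y => fderiv ℝ f y v)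
      (fun y => (hd' y).clm_apply (differentiableAt_const v)) x v 0
    rw [h.deriv, fderiv_clm_apply (hd' _) (differentiableAt_const v)]
    simp
  have hsd : ∀ t : ℝ, |f (x + t • v) + f (x + (-t) • v) - 2 * f (x + (0 : ℝ) • v)|
      ≤ t ^ 2 * sqNorm v := fun t => by
    have := h2 x (t • v)
    rw [sqNorm_smul, sub_eq_add_neg x, ← neg_smul] at this
    simpa only [zero_smul, add_zero] using this
  rw [abs_le]
  constructor
  · have := deriv_deriv_le_of_second_difference_le hline.neg (c := sqNorm v) fun t => by
      have := (abs_le.1 (hsd t)).1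
      linarith
    have e3 : deriv (deriv fun t : ℝ => -f (x + t • v)) 0 = -fderiv ℝ (fderiv ℝ f) x v v := by
      rw [← e2]; simp [deriv.fun_neg']
    linarith
  · rw [← e2]
    exact deriv_deriv_le_of_second_difference_le hline fun t => by
      have := (abs_le.1 (hsd t)).2
      linarith

lemma abs_fderiv_fderiv_le {f : (Fin d → ℝ) → ℝ} (hf : ContDiff ℝ 2 f)
    (h2 : ∀ x v, |f (x + v) + f (x - v) - 2 * f x| ≤ sqNorm v) (x u v : Fin d → ℝ) :
    |fderiv ℝ (fderiv ℝ f) x u v| ≤ (sqNorm u + sqNorm v) / 2 := by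
  have hsymm : fderiv ℝ (fderiv ℝ f) x u v = fderiv ℝ (fderiv ℝ f) x v u :=
    (hf.contDiffAt.isSymmSndFDerivAt (by simp)) u v
  have hp := abs_le.1 (abs_fderiv_fderiv_diag_le hf h2 x (u + v))
  have hm := abs_le.1 (abs_fderiv_fderiv_diag_le hf h2 x (u - v))
  simp only [map_add, map_sub, add_apply, sub_apply,
    hsymm] at hp hm
  have := sqNorm_add_add_sqNorm_sub u v
  rw [abs_le]
  constructor <;> linarith [hp.1, hp.2, hm.1, hm.2]

lemma fderiv_apply_le_one {f : (Fin d → ℝ) → ℝ} (hf : ContDiff ℝ 2 f)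
    (h0 : ∀ x, 0 ≤ f x) (h1 : ∀ x, f x ≤ 1)
    (h2 : ∀ x v, |f (x + v) + f (x - v) - 2 * f x| ≤ sqNorm v) (x v : Fin d → ℝ)
    (hv : sqNorm v ≤ 1) : fderiv ℝ f x v ≤ 1 := by
  have hd : Differentiable ℝ f := hf.differentiable (by norm_num)
  have hd' : Differentiable ℝ (fderiv ℝ f) :=
    (hf.fderiv_right (m := 1) (by norm_num)).differentiable (by norm_num)
  have e1 : deriv (fun t : ℝ => f (x + t • v)) = fun t => fderiv ℝ f (x + t • v) v :=
    funext fun t => (hasDerivAt_comp_line hd x v t).deriv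
  have := deriv_le_one_of_abs_deriv_deriv_le (φ := fun t : ℝ => f (x + t • v)) (by fun_prop)
    (fun t => h0 _) (fun t => h1 _) fun t => by
      rw [e1, (hasDerivAt_comp_line (f := fun y => fderiv ℝ f y v)
        (fun y => (hd' y).clm_apply (differentiableAt_const v)) x v t).deriv,
        fderiv_clm_apply (hd' _) (differentiableAt_const v)]
      simpa using (abs_fderiv_fderiv_diag_le hf h2 (x + t • v) v).trans hv
  rw [e1] at this
  simpa using this

lemma mem_Fkd_two_of_second_difference {f : (Fin d → ℝ) → ℝ} (hf : ContDiff ℝ 2 f)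
    (h0 : ∀ x, 0 ≤ f x) (h1 : ∀ x, f x ≤ 1)
    (h2 : ∀ x v, |f (x + v) + f (x - v) - 2 * f x| ≤ sqNorm v) (D : Set (Fin d → ℝ)) :
    f ∈ Fkd 2 d D := by
  refine ⟨hf.contDiffOn, fun α hα x _ => ?_⟩
  have hd' : Differentiable ℝ (fderiv ℝ f) :=
    (hf.fderiv_right (m := 1) (by norm_num)).differentiable (by norm_num)
  have hlen : ((List.finRange d).flatMap fun i => List.replicate (α i) i).length ≤ 2 := by
    refine le_trans (le_of_eq ?_) hα
    simp [List.length_flatMap, Fin.sum_univ_def]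
  unfold mderiv
  match (List.finRange d).flatMap fun i => List.replicate (α i) i, hlen with
  | [], _ => exact abs_le.2 ⟨by simpa using by linarith [h0 x], by simpa using h1 x⟩
  | [i], _ =>
    have hp := fderiv_apply_le_one hf h0 h1 h2 x (Pi.single i 1) (sqNorm_single i).le
    have hm := fderiv_apply_le_one hf h0 h1 h2 x (-Pi.single i 1)
      (by rw [← neg_one_smul ℝ, sqNorm_smul, sqNorm_single]; norm_num)
    rw [map_neg] at hm
    exact abs_le.2 ⟨by simpa [pderiv'] using by linarith, by simpa [pderiv'] using hp⟩
  | [i, j], _ =>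
    have h := abs_fderiv_fderiv_le hf h2 x (Pi.single i 1) (Pi.single j 1)
    rw [sqNorm_single, sqNorm_single] at h
    simp only [List.foldr_cons, List.foldr_nil, pderiv']
    unfold pderiv'
    rw [fderiv_clm_apply (hd' _) (differentiableAt_const _)]
    norm_num at h
    simpa using h
  | _ :: _ :: _ :: _, h => simp at h

end Derivatives

section Volume

open Real

/-- A weak form of Stirling's lower bound for the Gamma function. -/
lemma rpow_mul_exp_neg_le_Gamma_add_one {x : ℝ} (hx : 0 < x) :
    x ^ x * Real.exp (-x) ≤ Real.Gamma (x + 1) := by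
  have hi := Real.GammaIntegral_convergent (s := x + 1) (by positivity)
  rw [Real.Gamma_eq_integral (by positivity)]
  simp only [add_sub_cancel_right] at hi ⊢
  have hsub : Set.Ioi x ⊆ Set.Ioi 0 := Set.Ioi_subset_Ioi hx.le
  calc x ^ x * Real.exp (-x) = ∫ t in Set.Ioi x, Real.exp (-t) * x ^ x := by
        rw [integral_mul_const, integral_exp_neg_Ioi, mul_comm]
    _ ≤ ∫ t in Set.Ioi x, Real.exp (-t) * t ^ x := by
        refine setIntegral_mono_on ((integrableOn_exp_neg_Ioi x).mul_const _) (hi.mono_set hsub)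
          measurableSet_Ioi fun t ht => ?_
        have : x ^ x ≤ t ^ x := Real.rpow_le_rpow hx.le (le_of_lt ht) hx.le
        gcongr
    _ ≤ ∫ t in Set.Ioi 0, Real.exp (-t) * t ^ x := by
        refine setIntegral_mono_set hi ?_ hsub.eventuallyLE
        filter_upwards [ae_restrict_mem measurableSet_Ioi] with t ht
        have ht : 0 < t := ht
        positivity

variable {d : ℕ}

lemma measurableSet_sqNorm_sub_lt (x : Fin d → ℝ) (s : ℝ) :
    MeasurableSet {y | sqNorm (y - x) < s} :=
  (isOpen_lt (continuous_sqNorm.comp (continuous_id.sub continuous_const))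
    continuous_const).measurableSet

/-- An upper bound for the volume of the Euclidean ball of radius `√s`. -/
lemma volume_sqNorm_sub_lt_le (hd : 0 < d) (x : Fin d → ℝ) {s : ℝ} (hs : 0 ≤ s) :
    volume {y | sqNorm (y - x) < s} ≤
      ENNReal.ofReal ((2 * π * Real.exp 1 * s / d) ^ ((d : ℝ) / 2)) := by
  have : Nonempty (Fin d) := ⟨⟨0, hd⟩⟩
  have hd' : (0 : ℝ) < d := by exact_mod_cast hd
  have hpre : {y : Fin d → ℝ | sqNorm (y - x) < s} =
      WithLp.toLp 2 ⁻¹' Metric.ball (WithLp.toLp 2 x : EuclideanSpace ℝ (Fin d)) (√s) := by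
    ext y
    have h := Real.sqrt_lt_sqrt_iff (y := s) (sqNorm_nonneg (y - x))
    simpa [EuclideanSpace.dist_eq, sqNorm, Real.dist_eq, sq_abs] using h.symm
  rw [hpre, (PiLp.volume_preserving_toLp (Fin d)).measure_preimage
    measurableSet_ball.nullMeasurableSet, EuclideanSpace.volume_ball, Fintype.card_fin,
    ← ENNReal.ofReal_pow (Real.sqrt_nonneg _), ← ENNReal.ofReal_mul (by positivity)]
  refine ENNReal.ofReal_le_ofReal ?_
  have hpow : ∀ a : ℝ, 0 ≤ a → √a ^ d = a ^ ((d : ℝ) / 2) := fun a ha => by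
    rw [← Real.rpow_natCast, Real.sqrt_eq_rpow, ← Real.rpow_mul ha]; ring_nf
  rw [hpow _ hs, hpow _ pi_pos.le]
  have hG := rpow_mul_exp_neg_le_Gamma_add_one (x := (d : ℝ) / 2) (by positivity)
  have hexp : Real.exp (-((d : ℝ) / 2)) = ((Real.exp 1) ^ ((d : ℝ) / 2))⁻¹ := by
    rw [← Real.exp_mul, one_mul, Real.exp_neg]
  calc s ^ ((d : ℝ) / 2) * (π ^ ((d : ℝ) / 2) / Real.Gamma (d / 2 + 1))
      ≤ s ^ ((d : ℝ) / 2) * (π ^ ((d : ℝ) / 2) /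
          (((d : ℝ) / 2) ^ ((d : ℝ) / 2) * Real.exp (-((d : ℝ) / 2)))) := by gcongr
    _ = (2 * π * Real.exp 1 * s / d) ^ ((d : ℝ) / 2) := by
        rw [hexp, show 2 * π * Real.exp 1 * s / d = s * (π / (d / 2 * (Real.exp 1)⁻¹)) by
            field_simp,
          Real.mul_rpow (by positivity) (by positivity),
          Real.div_rpow pi_pos.le (by positivity),
          Real.mul_rpow (x := (d : ℝ) / 2) (by positivity) (by positivity),
          Real.inv_rpow (by positivity)]

end Volume

section Fooling

variable {d : ℕ}

/-- A fooling function: it vanishes at the given points and equals `h` outside of the Euclidean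
balls of radius `√(22 h)` around them. -/
lemma exists_fooling_function_s3 (hd : 0 < d) {n : ℕ} (x : Fin n → Fin d → ℝ) {h : ℝ} (hh : 0 < h)
    (hh1 : h ≤ 1) (D : Set (Fin d → ℝ)) :
    ∃ f ∈ Fkd 2 d D, Continuous f ∧ (∀ y, 0 ≤ f y) ∧ (∀ y, f y ≤ h) ∧ (∀ i, f (x i) = 0) ∧
      ∀ y, (∀ i, 22 * h ≤ sqNorm (y - x i)) → f y = h := by
  have hd' : (0 : ℝ) < d := by exact_mod_cast hd
  obtain ⟨k, hkm, hk0, hkh, hk2, hkS, hkfar⟩ :=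
    exists_semiconvex_semiconcave {y | ∃ i, sqNorm (y - x i) ≤ h} hh.le
  have hδ : 0 < √(h / d) := by positivity
  obtain ⟨f, hf, hf0, hfh, hf2, hfc⟩ := exists_contDiff_mollification hδ hkm hk0 hkh hk2
  have hball : ∀ y, ∀ z ∈ Metric.ball y √(h / d), sqNorm (z - y) ≤ h := fun y z hz => by
    calc sqNorm (z - y) ≤ ∑ _i : Fin d, h / d := by
          refine Finset.sum_le_sum fun i _ => ?_
          have h1 : |(z - y) i| < √(h / d) := by
            have := (dist_le_pi_dist z y i).trans_lt hz
            rwa [Real.dist_eq] at this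
          rw [← sq_abs, ← Real.sq_sqrt (show 0 ≤ h / d by positivity)]
          gcongr
      _ = h := by simp; field_simp
  refine ⟨f, mem_Fkd_two_of_second_difference hf hf0 (fun y => (hfh y).trans hh1) hf2 D,
    hf.continuous, hf0, hfh, fun i => hfc _ _ fun z hz => hkS z ⟨i, hball _ z hz⟩,
    fun y hy => hfc _ _ fun z hz => hkfar z ?_⟩
  rintro w ⟨i, hw⟩
  have h1 := hball y z hz
  rw [sqNorm_sub_comm] at h1
  linarith [hy i, sqNorm_sub_le y z (x i), sqNorm_sub_le z w (x i)]

lemma le_setIntegral_of_eq_off {D B : Set (Fin d → ℝ)} (hDvol : volume D = 1)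
    (hB : MeasurableSet B) {b h : ℝ} (hb : 0 ≤ b)
    (hBvol : volume B ≤ ENNReal.ofReal b) (hh : 0 ≤ h) {f : (Fin d → ℝ) → ℝ} (hf : Continuous f)
    (hf0 : ∀ y, 0 ≤ f y) (hfh : ∀ y, f y ≤ h) (hfB : ∀ y ∉ B, f y = h) :
    h * (1 - b) ≤ ∫ t in D, f t := by
  have : IsProbabilityMeasure (volume.restrict D) := ⟨by simpa using hDvol⟩
  have hreal : (volume.restrict D).real B ≤ b := by
    refine ENNReal.toReal_le_of_le_ofReal hb ((Measure.restrict_apply_le _ _).trans hBvol)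
  have hfi : Integrable f (volume.restrict D) :=
    Integrable.of_bound hf.aestronglyMeasurable h
      (Eventually.of_forall fun y => by rw [Real.norm_of_nonneg (hf0 y)]; exact hfh y)
  calc h * (1 - b) ≤ h * (volume.restrict D).real Bᶜ := by
        rw [probReal_compl_eq_one_sub hB]; gcongr
    _ = ∫ t in D, Bᶜ.indicator (fun _ => h) t := by
        rw [integral_indicator_const _ hB.compl, smul_eq_mul, mul_comm]
    _ ≤ ∫ t in D, f t := by
        refine integral_mono ((integrable_const h).indicator hB.compl) hfi fun y => ?_
        by_cases hy : y ∈ B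
        · simpa [hy] using hf0 y
        · simp [hy, hfB y hy]

/-- A lower bound for the minimal error in terms of the volume of Euclidean balls. -/
lemma le_interr (hd : 0 < d) {D : Set (Fin d → ℝ)} (hDvol : volume D = 1)
    {h : ℝ} (hh : 0 < h) (hh1 : h ≤ 1) (n : ℕ) :
    h * (1 - n * (2 * Real.pi * Real.exp 1 * (22 * h) / d) ^ ((d : ℝ) / 2))
      ≤ interr D (Fkd 2 d D) n := by
  have hne : Nonempty D := by
    rw [Set.nonempty_coe_sort]
    exact nonempty_of_measure_ne_zero (μ := volume) (by simp [hDvol])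
  have hprob : IsProbabilityMeasure (volume.restrict D) := ⟨by simpa using hDvol⟩
  refine le_ciInf fun x => ?_
  obtain ⟨f, hfF, hfc, hf0, hfh, hfx, hfar⟩ :=
    exists_fooling_function_s3 hd (fun i => (x i : Fin d → ℝ)) hh hh1 D
  refine le_csSup_of_le ⟨1, ?_⟩ ⟨f, ⟨hfF, hfx⟩, rfl⟩ ?_
  · rintro _ ⟨g, ⟨⟨_, hg⟩, _⟩, rfl⟩
    have hg1 : ∀ t ∈ D, ‖g t‖ ≤ 1 := fun t ht => by
      have hnil : (List.finRange d).flatMap (fun _ => ([] : List (Fin d))) = [] := by simp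
      simpa [mderiv, hnil] using hg 0 (by simp) t ht
    have := norm_setIntegral_le_of_norm_le_const (μ := volume) (by simp [hDvol]) hg1
    simpa [Measure.real, hDvol] using (le_abs_self _).trans this
  · have hs : (0 : ℝ) ≤ 22 * h := by positivity
    refine le_setIntegral_of_eq_off hDvol
      (B := ⋃ i, {y | sqNorm (y - (x i : Fin d → ℝ)) < 22 * h})
      (MeasurableSet.iUnion fun i => measurableSet_sqNorm_sub_lt _ _) (by positivity) ?_ hh.le
      hfc hf0 hfh fun y hy => hfar y fun i => ?_
    · refine (measure_iUnion_fintype_le _ _).trans ?_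
      refine (Finset.sum_le_sum fun i _ => volume_sqNorm_sub_lt_le hd _ hs).trans (le_of_eq ?_)
      rw [Finset.sum_const, Finset.card_univ, Fintype.card_fin, nsmul_eq_mul,
        ENNReal.ofReal_mul (by positivity), ENNReal.ofReal_natCast]
    · by_contra! hlt
      exact hy (Set.mem_iUnion.2 ⟨i, hlt⟩)

end Fooling

/-- Explicit lower bound for the information complexity of integration on `F²_d(D)` for an
arbitrary open domain `D` of measure one: any `n` with `e(n, F²_d(D)) ≤ ε` satisfies
`n ≥ (2/(2+d)) ((1/533) (d/(d+2)) (d/ε))^{d/2}`. -/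
theorem complexity_lower_bound_F2d (d : ℕ) (hd : 0 < d) (D : Set (Fin d → ℝ))
    (hDopen : IsOpen D) (hDvol : volume D = 1)
    (ε : ℝ) (hε : ε ∈ Set.Ioo (0 : ℝ) ((d : ℝ) / (d + 2)))
    (n : ℕ) (hn : interr D (Fkd 2 d D) n ≤ ε) :
    (2 / (2 + d) : ℝ) * ((1 / 533) * ((d : ℝ) / (d + 2)) * ((d : ℝ) / ε)) ^ ((d : ℝ) / 2)
      ≤ (n : ℝ) := by
  
  obtain ⟨hε0, hε1⟩ := hε
  have hd' : (0 : ℝ) < d := by exact_mod_cast hd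
  set h : ℝ := ε * (d + 2) / d with hh
  have hh0 : 0 < h := by positivity
  have hh1 : h ≤ 1 := by
    rw [hh, div_le_one hd']
    exact ((lt_div_iff₀ (by positivity)).1 hε1).le
  have hle := (le_interr hd hDvol hh0 hh1 n).trans hn
  set p : ℝ := (2 * Real.pi * Real.exp 1 * (22 * h) / d) ^ ((d : ℝ) / 2) with hp
  set N : ℝ := ((1 / 533) * ((d : ℝ) / (d + 2)) * ((d : ℝ) / ε)) ^ ((d : ℝ) / 2) with hN
  have hN0 : 0 < N := by positivity
  have hpN : p ≤ N⁻¹ := by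
    rw [hp, hN, ← Real.inv_rpow (by positivity)]
    refine Real.rpow_le_rpow (by positivity) ?_ (by positivity)
    have h1 : (1 / 533 * ((d : ℝ) / (d + 2)) * (d / ε))⁻¹ = 533 * h / d := by
      rw [hh]; field_simp
    rw [h1]
    have h2 : Real.pi * Real.exp 1 ≤ 3.15 * 2.72 := by
      have := Real.pi_lt_d2
      have := Real.exp_one_lt_d9
      gcongr; linarith
    refine div_le_div_of_nonneg_right ?_ hd'.le
    nlinarith
  have hε' : ε = h * (d / (d + 2)) := by rw [hh]; field_simp
  have hkey : 1 - n * p ≤ d / (d + 2) := by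
    refine le_of_mul_le_mul_left ?_ hh0
    rwa [← hε']
  have hsum : (d : ℝ) / (d + 2) + 2 / (2 + d) = 1 := by field_simp; ring
  have h3 : 2 / (2 + d) ≤ n * N⁻¹ := by
    have : (n : ℝ) * p ≤ n * N⁻¹ := by gcongr
    linarith
  rwa [← div_eq_mul_inv, le_div_iff₀ hN0] at h3
end

section
/- Let n ∈ ℕ and let M ∈ ℝ^{n×n} be a positive semi-definite matrix. Then the matrix M ∘ M − (1/n) (diag M)(diag M)^T is positive semi-definite, where M ∘ M denotes the entrywise (Schur/Hadamard) product and diag M = (M_{1,1},…,M_{n,n})^T ∈ ℝⁿ is the column vector of diagonal entries of M. -/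
open scoped MatrixOrder Matrix in
theorem Matrix.PosSemidef.exists_eq_transpose_mul_self {ι : Type*} [Fintype ι]
    {M : Matrix ι ι ℝ} (hM : M.PosSemidef) : ∃ B : Matrix ι ι ℝ, M = Bᵀ * B := by
  classical
  obtain ⟨B, hB⟩ := CStarAlgebra.nonneg_iff_eq_star_mul_self.mp hM.nonneg
  exact ⟨B, by simpa [Matrix.star_eq_conjTranspose] using hB⟩

open scoped Matrix in
theorem Matrix.sq_trace_le_card_mul_trace_transpose_mul_self {ι : Type*} [Fintype ι]
    (C : Matrix ι ι ℝ) : C.trace ^ 2 ≤ Fintype.card ι * (Cᵀ * C).trace := by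
  refine (sq_sum_le_card_mul_sum_sq (s := Finset.univ) (f := C.diag)).trans ?_
  refine mul_le_mul_of_nonneg_left (Finset.sum_le_sum fun i _ => ?_) (Nat.cast_nonneg _)
  simp only [Matrix.diag_apply, Matrix.mul_apply, Matrix.transpose_apply, ← sq]
  exact Finset.single_le_sum (f := fun j => C j i ^ 2) (fun j _ => sq_nonneg _)
    (Finset.mem_univ i)

open scoped Matrix in
/-- The quadratic form of `M ∘ M` is at least that of `(1/n)(diag M)(diag M)ᵀ`. -/
theorem Matrix.PosSemidef.sq_dotProduct_diag_le {ι : Type*} [Fintype ι]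
    {M : Matrix ι ι ℝ} (hM : M.PosSemidef) (x : ι → ℝ) :
    (x ⬝ᵥ M.diag) ^ 2 ≤ Fintype.card ι * (x ⬝ᵥ (M.hadamard M) *ᵥ x) := by
  classical
  obtain ⟨B, rfl⟩ := hM.exists_eq_transpose_mul_self
  have h := Matrix.sq_trace_le_card_mul_trace_transpose_mul_self (B * Matrix.diagonal x * Bᵀ)
  have htrace : (B * Matrix.diagonal x * Bᵀ).trace = x ⬝ᵥ (Bᵀ * B).diag := by
    rw [Matrix.trace_mul_comm, ← Matrix.mul_assoc]
    simp [Matrix.trace, dotProduct, mul_comm]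
  have hnorm : ((B * Matrix.diagonal x * Bᵀ)ᵀ * (B * Matrix.diagonal x * Bᵀ)).trace
      = x ⬝ᵥ ((Bᵀ * B).hadamard (Bᵀ * B)) *ᵥ x := by
    have hcyc : ((B * Matrix.diagonal x * Bᵀ)ᵀ * (B * Matrix.diagonal x * Bᵀ)).trace
        = (Matrix.diagonal x * (Bᵀ * B) * (Matrix.diagonal x * (Bᵀ * B))).trace := by
      rw [Matrix.transpose_mul, Matrix.transpose_mul, Matrix.transpose_transpose,
        Matrix.diagonal_transpose, Matrix.mul_assoc, Matrix.trace_mul_comm]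
      simp only [Matrix.mul_assoc]
    have hsymm : (Bᵀ * B)ᵀ = Bᵀ * B := by simp
    rw [hcyc]
    generalize Bᵀ * B = M at hsymm
    simp only [Matrix.trace, dotProduct, Matrix.mulVec, Matrix.diag_apply,
      Matrix.mul_apply (M := Matrix.diagonal x * M),
      Matrix.diagonal_mul, Matrix.hadamard_apply, Finset.mul_sum]
    refine Finset.sum_congr rfl fun i _ => Finset.sum_congr rfl fun j _ => ?_
    rw [show M j i = M i j from congrFun₂ hsymm i j]
    ring
  rwa [htrace, hnorm] at h

/-- Vybíral's improvement of the Schur product theorem: if `M` is positive semi-definite then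
so is `M ∘ M - (1/n)(diag M)(diag M)ᵀ`, where `∘` is the entrywise (Hadamard) product and
`diag M` is the column vector of diagonal entries of `M`. -/
theorem schur_product_improved (n : ℕ) (hn : 0 < n)
    (M : Matrix (Fin n) (Fin n) ℝ) (hM : M.PosSemidef) :
    (M.hadamard M - (1 / n : ℝ) • Matrix.vecMulVec M.diag M.diag).PosSemidef := by
  refine .of_dotProduct_mulVec_nonneg ((hM.hadamard hM).isHermitian.sub ?_) fun x => ?_
  · ext i j
    simp [Matrix.vecMulVec_apply, mul_comm]
  · have h := hM.sq_dotProduct_diag_le x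
    rw [Fintype.card_fin] at h
    have hn' : (0 : ℝ) < n := by exact_mod_cast hn
    simp only [star_trivial, Matrix.sub_mulVec, Matrix.smul_mulVec, Matrix.vecMulVec_mulVec,
      dotProduct_sub, dotProduct_smul, sub_nonneg, smul_eq_mul, MulOpposite.smul_eq_mul_unop,
      MulOpposite.unop_op]
    rw [dotProduct_comm M.diag x, one_div, inv_mul_le_iff₀ hn']
    simpa [sq] using h
end

section
/- Let H be a real Hilbert space, D a nonempty set, Φ : D → H a map, h ∈ H, α > 0 and n ∈ ℕ. Then the following two statements are equivalent: (i) for all x₁,…,xₙ ∈ D and all a₁,…,aₙ ∈ ℝ one has ‖h − Σ_{i=1}^n aᵢ Φ(xᵢ)‖² ≥ ‖h‖² − α^{−1}; (ii) for all x₁,…,xₙ ∈ D the n×n matrix with entries ⟨Φ(xᵢ), Φ(x_k)⟩ − α ⟨h, Φ(xᵢ)⟩ ⟨h, Φ(x_k)⟩ (i,k = 1,…,n) is positive semi-definite. -/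
open RealInnerProductSpace

/-- The quadratic form of the Gram matrix minus a rank-one term, expressed through the
linear combination `∑ aᵢ vᵢ`. -/
theorem dotProduct_gram_sub_mulVec {H : Type*} [NormedAddCommGroup H] [InnerProductSpace ℝ H]
    {ι : Type*} [Fintype ι] (v : ι → H) (h : H) (α : ℝ) (a : ι → ℝ) :
    a ⬝ᵥ (Matrix.of fun i k : ι => ⟪v i, v k⟫ - α * (⟪h, v i⟫ * ⟪h, v k⟫)).mulVec a =
      ‖∑ i, a i • v i‖ ^ 2 - α * ⟪h, ∑ i, a i • v i⟫ ^ 2 := by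
  rw [← real_inner_self_eq_norm_sq, sq, sum_inner, inner_sum, Finset.sum_mul_sum,
    Finset.mul_sum, ← Finset.sum_sub_distrib]
  simp only [dotProduct, Matrix.mulVec, Matrix.of_apply, Finset.mul_sum, inner_sum]
  refine Finset.sum_congr rfl fun i _ => ?_
  rw [← Finset.sum_sub_distrib]
  refine Finset.sum_congr rfl fun k _ => ?_
  simp only [real_inner_smul_left, real_inner_smul_right]
  ring

/-- A bound on the distance of `h` to the line through `g` is equivalent to a Cauchy–Schwarz-type
inequality between `h` and `g`. -/
theorem forall_norm_sub_smul_sq_ge_iff {H : Type*} [NormedAddCommGroup H] [InnerProductSpace ℝ H]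
    (h g : H) {α : ℝ} (hα : 0 < α) :
    (∀ t : ℝ, ‖h‖ ^ 2 - α⁻¹ ≤ ‖h - t • g‖ ^ 2) ↔ α * ⟪h, g⟫ ^ 2 ≤ ‖g‖ ^ 2 := by
  have expand (t : ℝ) : ‖h - t • g‖ ^ 2 = ‖h‖ ^ 2 - 2 * (t * ⟪h, g⟫) + t ^ 2 * ‖g‖ ^ 2 := by
    rw [norm_sub_sq_real, real_inner_smul_right, norm_smul, mul_pow, Real.norm_eq_abs, sq_abs]
  simp only [expand]
  constructor
  · intro H
    by_cases hc : ⟪h, g⟫ = 0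
    · simp [hc]
    · have key := H (α * ⟪h, g⟫)⁻¹
      have e : (α * ⟪h, g⟫)⁻¹ * ⟪h, g⟫ = α⁻¹ := by field_simp
      rw [e] at key
      have hpos : 0 < (α * ⟪h, g⟫) ^ 2 := by positivity
      have key' : α⁻¹ ≤ ‖g‖ ^ 2 / (α * ⟪h, g⟫) ^ 2 := by
        rw [div_eq_inv_mul, ← inv_pow]
        linarith
      rw [le_div_iff₀ hpos] at key'
      calc α * ⟪h, g⟫ ^ 2 = α⁻¹ * (α * ⟪h, g⟫) ^ 2 := by field_simp
        _ ≤ ‖g‖ ^ 2 := key'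
  · intro H t
    have h1 : t ^ 2 * (α * ⟪h, g⟫ ^ 2) ≤ t ^ 2 * ‖g‖ ^ 2 := by gcongr
    have h2 : 0 ≤ α⁻¹ * (α * (t * ⟪h, g⟫) - 1) ^ 2 := by positivity
    have h3 : α⁻¹ * (α * (t * ⟪h, g⟫) - 1) ^ 2 =
        t ^ 2 * (α * ⟪h, g⟫ ^ 2) - 2 * (t * ⟪h, g⟫) + α⁻¹ := by
      field_simp
      ring
    linarith

/-- Lower bounds for quadrature in a reproducing kernel Hilbert space with feature map `Φ`
and representer `h` are equivalent to positive semi-definiteness of the matrices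
`(⟨Φ(xᵢ),Φ(x_k)⟩ - α ⟨h,Φ(xᵢ)⟩⟨h,Φ(x_k)⟩)`. -/
theorem quadrature_lower_bound_iff_posSemidef
    {H : Type} [NormedAddCommGroup H] [InnerProductSpace ℝ H]
    {D : Type} [Nonempty D] (Φ : D → H) (h : H) (α : ℝ) (hα : 0 < α) (n : ℕ) :
    (∀ (x : Fin n → D) (a : Fin n → ℝ),
        ‖h‖ ^ 2 - α⁻¹ ≤ ‖h - ∑ i, a i • Φ (x i)‖ ^ 2) ↔
    (∀ x : Fin n → D,
        (Matrix.of fun i k : Fin n =>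
          ⟪Φ (x i), Φ (x k)⟫ - α * (⟪h, Φ (x i)⟫ * ⟪h, Φ (x k)⟫)).PosSemidef) := by
  refine forall_congr' fun x => ?_
  have herm : (Matrix.of fun i k : Fin n =>
      ⟪Φ (x i), Φ (x k)⟫ - α * (⟪h, Φ (x i)⟫ * ⟪h, Φ (x k)⟫)).IsHermitian := by
    ext i k
    simp [real_inner_comm, mul_comm]
  rw [Matrix.posSemidef_iff_dotProduct_mulVec, and_iff_right herm]
  simp only [star_trivial, dotProduct_gram_sub_mulVec (fun i => Φ (x i)), sub_nonneg,
    ← forall_norm_sub_smul_sq_ge_iff h _ hα]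
  constructor
  · intro H a t
    simpa only [Finset.smul_sum, smul_smul] using H fun i => t * a i
  · intro H a
    simpa only [one_smul] using H a 1
end

section
/- Let d, n ∈ ℕ. For each i = 1,…,d let D_i be a nonempty set, let h_i, f_i, g_i : D_i → ℝ be functions and α_i ∈ (0,1] numbers such that h_i(x) ≥ 0 and (α_i h_i(x))² = f_i(x)² + g_i(x)² for all x ∈ D_i. Set b^i_0 = h_i, b^i_1 = f_i, b^i_2 = g_i, and for coefficients c : {0,1,2}^d → ℝ define F_c : D_1 × ⋯ × D_d → ℝ by F_c(t) = Σ_{j ∈ {0,1,2}^d} c_j ∏_{i=1}^d b^i_{j_i}(t_i). Then for all nodes t⁽¹⁾,…,t⁽ⁿ⁾ ∈ D_1 × ⋯ × D_d and all weights a₁,…,aₙ ∈ ℝ: sup{ ( c_{(0,…,0)} − Σ_{k=1}^n a_k F_c(t⁽ᵏ⁾) )² : Σ_j c_j² ≤ 1 } ≥ 1 − n ∏_{i=1}^d (1 + α_i²)^{−1}. -/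
/-- The tensor product function `F_c(t) = Σ_{j ∈ {0,1,2}^d} c_j ∏_i b^i_{j_i}(t_i)` built from
the univariate functions `b^i_0 = h i`, `b^i_1 = f i`, `b^i_2 = g i`. -/
noncomputable def tensorFun {d : ℕ} {D : Fin d → Type}
    (h f g : (i : Fin d) → D i → ℝ) (c : (Fin d → Fin 3) → ℝ)
    (t : (i : Fin d) → D i) : ℝ :=
  ∑ j : Fin d → Fin 3, c j * ∏ i, (![h i, f i, g i] : Fin 3 → D i → ℝ) (j i) (t i)

open Finset in
/-- A sum of squares of linear forms in `a`, written as a quadratic form with a Gram kernel. -/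
theorem sum_sq_linear_eq_gram_form {ι J : Type*} [Fintype ι] [Fintype J] (a : ι → ℝ)
    (b : J → ι → ℝ) :
    ∑ j, (∑ k, a k * b j k) ^ 2 = ∑ k, ∑ l, a k * a l * ∑ j, b j k * b j l := by
  simp only [sq, sum_mul_sum]
  rw [sum_comm]
  refine sum_congr rfl fun k _ => ?_
  rw [sum_comm]
  refine sum_congr rfl fun l _ => ?_
  rw [mul_sum]
  exact sum_congr rfl fun j _ => mul_mul_mul_comm _ _ _ _

open Finset MatrixOrder Matrix.Norms.L2Operator in
/-- For a Gram matrix `M` of size `n`, `(∑ a_k M_kk)² ≤ n ∑ a_k a_l M_kl²`; equivalently, the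
Hadamard square of `M` dominates `n⁻¹ (diag M) (diag M)ᵀ`. -/
theorem sq_sum_mul_diag_gram_le {n : ℕ} {E : Type*} [Fintype E] (u : Fin n → E → ℝ)
    (a : Fin n → ℝ) :
    (∑ k, a k * ∑ e, u k e * u k e) ^ 2 ≤
      n * ∑ k, ∑ l, a k * a l * (∑ e, u k e * u l e) ^ 2 := by
  have hM : (Matrix.of u * (Matrix.of u).conjTranspose).PosSemidef :=
    Matrix.posSemidef_self_mul_conjTranspose _
  obtain ⟨B, hB⟩ := CStarAlgebra.nonneg_iff_eq_star_mul_self.mp hM.nonneg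
  have hent : ∀ k l, ∑ e, u k e * u l e = ∑ p, B p k * B p l := by
    intro k l
    simpa [Matrix.mul_apply, Matrix.star_apply] using congrFun (congrFun hB k) l
  simp only [hent]
  have htr : ∑ k, a k * ∑ p, B p k * B p k = ∑ p, ∑ k, a k * (B p k * B p k) := by
    simp only [mul_sum]
    exact sum_comm
  have hfrob : ∑ k, ∑ l, a k * a l * (∑ p, B p k * B p l) ^ 2 =
      ∑ p, ∑ q, (∑ k, a k * (B p k * B q k)) ^ 2 := by
    rw [← sum_product' univ univ fun p q => (∑ k, a k * (B p k * B q k)) ^ 2, univ_product_univ]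
    rw [sum_sq_linear_eq_gram_form a fun (r : Fin n × Fin n) k => B r.1 k * B r.2 k]
    refine sum_congr rfl fun k _ => sum_congr rfl fun l _ => ?_
    rw [sq, sum_mul_sum, ← sum_product', univ_product_univ]
    exact congrArg _ (sum_congr rfl fun r _ => mul_mul_mul_comm _ _ _ _)
  rw [htr, hfrob]
  calc (∑ p, ∑ k, a k * (B p k * B p k)) ^ 2
      ≤ n * ∑ p, (∑ k, a k * (B p k * B p k)) ^ 2 := by
        simpa using sq_sum_le_card_mul_sum_sq (s := univ) (f := fun p => ∑ k, a k * (B p k * B p k))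
    _ ≤ n * ∑ p, ∑ q, (∑ k, a k * (B p k * B q k)) ^ 2 := by
        gcongr with p
        exact single_le_sum (f := fun q => (∑ k, a k * (B p k * B q k)) ^ 2)
          (fun q _ => sq_nonneg _) (mem_univ p)

/-- The planar half-angle parametrization: if `(α h)² = f² + g²`, then `(f, g)` is `α` times
the complex square of a vector of squared length `h`. -/
theorem exists_half_angle {α h f g : ℝ} (hα : 0 < α) (hh : 0 ≤ h)
    (hs : (α * h) ^ 2 = f ^ 2 + g ^ 2) :
    ∃ p q : ℝ, p * p + q * q = h ∧ f = α * (p * p - q * q) ∧ g = α * (2 * (p * q)) := by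
  obtain ⟨w, hw⟩ := IsAlgClosed.exists_pow_nat_eq (⟨f / α, g / α⟩ : ℂ) two_pos
  have hre : w.re * w.re - w.im * w.im = f / α := by
    simpa [sq] using congrArg Complex.re hw
  have him : w.re * w.im + w.im * w.re = g / α := by
    simpa [sq] using congrArg Complex.im hw
  have hf : f = α * (w.re * w.re - w.im * w.im) := by rw [hre]; field_simp
  have hg : g = α * (2 * (w.re * w.im)) := by
    rw [show 2 * (w.re * w.im) = w.re * w.im + w.im * w.re by ring, him]; field_simp
  refine ⟨w.re, w.im, ?_, hf, hg⟩
  have hsq : (w.re * w.re + w.im * w.im) ^ 2 = h ^ 2 := by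
    have : α ^ 2 * (w.re * w.re + w.im * w.im) ^ 2 = α ^ 2 * h ^ 2 := by
      rw [← mul_pow α h, hs, hf, hg]; ring
    exact mul_left_cancel₀ (by positivity) this
  exact (pow_left_inj₀ (add_nonneg (mul_self_nonneg _) (mul_self_nonneg _)) hh two_ne_zero).mp hsq

/-- The univariate kernel `h h' + f f' + g g'` is a nonnegative combination of squares of two
Gram kernels, each with diagonal `h`. -/
theorem exists_kernel_eq_sum_sq {X : Type*} {h f g : X → ℝ} {α : ℝ} (hα : 0 < α)
    (hpos : ∀ x, 0 ≤ h x) (hsum : ∀ x, (α * h x) ^ 2 = f x ^ 2 + g x ^ 2) :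
    ∃ u : Fin 2 → X → Fin 2 → ℝ, (∀ r x, ∑ e, u r x e * u r x e = h x) ∧
      ∀ x y, ∑ m, (![h, f, g] : Fin 3 → X → ℝ) m x * (![h, f, g] : Fin 3 → X → ℝ) m y =
        ∑ r, (![1 - α ^ 2, 2 * α ^ 2] : Fin 2 → ℝ) r * (∑ e, u r x e * u r y e) ^ 2 := by
  choose p q hpq hf hg using fun x => exists_half_angle hα (hpos x) (hsum x)
  refine ⟨![fun x => ![√(h x), 0], fun x => ![p x, q x]], fun r x => ?_, fun x y => ?_⟩
  · fin_cases r
    · simp [Real.mul_self_sqrt (hpos x)]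
    · simpa using hpq x
  · simp only [Fin.sum_univ_three, Fin.sum_univ_two, Matrix.cons_val, mul_zero, add_zero, mul_pow,
      Real.sq_sqrt (hpos _), hf, hg]
    rw [← hpq x, ← hpq y]
    ring

open Finset in
/-- The quadratic form of the tensor product kernel dominates `n⁻¹ ∏ (1 + α_i²)` times the
squared quadrature value of `⊗ h_i`. -/
theorem prod_mul_sq_le_kernel_form {d n : ℕ} {D : Fin d → Type*}
    (h f g : (i : Fin d) → D i → ℝ) (α : Fin d → ℝ)
    (hα : ∀ i, α i ∈ Set.Ioc (0 : ℝ) 1)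
    (hpos : ∀ i x, 0 ≤ h i x)
    (hsum : ∀ i x, (α i * h i x) ^ 2 = f i x ^ 2 + g i x ^ 2)
    (t : Fin n → (i : Fin d) → D i) (a : Fin n → ℝ) :
    (∏ i, (1 + α i ^ 2)) * (∑ k, a k * ∏ i, h i (t k i)) ^ 2 ≤
      n * ∑ k, ∑ l, a k * a l * ∏ i, ∑ m,
        (![h i, f i, g i] : Fin 3 → D i → ℝ) m (t k i) *
          (![h i, f i, g i] : Fin 3 → D i → ℝ) m (t l i) := by
  choose u hdiag hker using fun i => exists_kernel_eq_sum_sq (hα i).1 (hpos i) (hsum i)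
  set w : Fin d → Fin 2 → ℝ := fun i => ![1 - α i ^ 2, 2 * α i ^ 2] with hw
  have hw0 : ∀ i r, 0 ≤ w i r := by
    intro i r
    have := (hα i).1
    have := (hα i).2
    fin_cases r
    · simp only [hw, Fin.zero_eta, Matrix.cons_val_zero]; nlinarith
    · simp only [hw, Fin.mk_one, Matrix.cons_val_one, Matrix.cons_val_fin_one]; positivity
  have hC : ∏ i, (1 + α i ^ 2) = ∑ σ : Fin d → Fin 2, ∏ i, w i (σ i) := by
    rw [← Fintype.prod_sum]
    refine prod_congr rfl fun i _ => ?_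
    simp only [hw, Fin.sum_univ_two, Matrix.cons_val]
    ring
  set U : (Fin d → Fin 2) → Fin n → (Fin d → Fin 2) → ℝ :=
    fun σ k e => ∏ i, u i (σ i) (t k i) (e i) with hU
  have hgram : ∀ σ k l, ∑ e, U σ k e * U σ l e =
      ∏ i, ∑ e, u i (σ i) (t k i) e * u i (σ i) (t l i) e := by
    intro σ k l
    simp only [hU, ← prod_mul_distrib, Fintype.prod_sum]
  have hprod : ∀ k l, (∏ i, ∑ m, (![h i, f i, g i] : Fin 3 → D i → ℝ) m (t k i) *
      (![h i, f i, g i] : Fin 3 → D i → ℝ) m (t l i)) =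
      ∑ σ : Fin d → Fin 2, (∏ i, w i (σ i)) * (∑ e, U σ k e * U σ l e) ^ 2 := by
    intro k l
    simp only [hker, hgram, ← prod_pow, ← prod_mul_distrib]
    exact Fintype.prod_sum _
  have hform : (n : ℝ) * ∑ k, ∑ l, a k * a l * (∏ i, ∑ m,
      (![h i, f i, g i] : Fin 3 → D i → ℝ) m (t k i) *
        (![h i, f i, g i] : Fin 3 → D i → ℝ) m (t l i)) =
      ∑ σ : Fin d → Fin 2, (∏ i, w i (σ i)) *
        (n * ∑ k, ∑ l, a k * a l * (∑ e, U σ k e * U σ l e) ^ 2) := by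
    simp only [hprod, mul_sum]
    rw [sum_comm_cycle]
    refine sum_congr rfl fun σ _ => sum_congr rfl fun k _ => sum_congr rfl fun l _ => ?_
    ring
  rw [hform, hC, sum_mul]
  refine sum_le_sum fun σ _ => mul_le_mul_of_nonneg_left ?_ (prod_nonneg fun i _ => hw0 i _)
  simpa only [hgram, hdiag] using sq_sum_mul_diag_gram_le (U σ) a

open Finset in
/-- The supremum of a squared linear form over the Euclidean unit ball is at least (in fact equal
to) the squared norm of its coefficient vector. -/
theorem sum_sq_le_sSup_sq_linear {J : Type*} [Fintype J] (v : J → ℝ) :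
    ∑ j, v j ^ 2 ≤
      sSup {y : ℝ | ∃ c : J → ℝ, (∑ j, c j ^ 2) ≤ 1 ∧ y = (∑ j, c j * v j) ^ 2} := by
  have hQ : 0 ≤ ∑ j, v j ^ 2 := sum_nonneg fun j _ => sq_nonneg _
  refine le_csSup ⟨∑ j, v j ^ 2, ?_⟩ ⟨fun j => v j / √(∑ j, v j ^ 2), ?_, ?_⟩
  · rintro y ⟨c, hc, rfl⟩
    exact (sum_mul_sq_le_sq_mul_sq univ c v).trans (mul_le_of_le_one_left hQ hc)
  · simp only [div_pow, Real.sq_sqrt hQ, ← sum_div]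
    exact div_self_le_one _
  · have : ∑ j, v j / √(∑ j, v j ^ 2) * v j = √(∑ j, v j ^ 2) := by
      simp only [div_mul_eq_mul_div, ← sq, ← sum_div, Real.div_sqrt]
    rw [this, Real.sq_sqrt hQ]

/-- Hinrichs–Krieg–Novak–Vybíral tensor product lower bound: if `h_i ≥ 0` and
`(α_i h_i)² = f_i² + g_i²` pointwise with `α_i ∈ (0,1]`, then for all nodes and weights the
worst-case squared quadrature error over the coefficient unit ball is at least
`1 - n ∏ (1+α_i²)⁻¹`. -/
theorem tensor_product_lower_bound (d n : ℕ) (hd : 0 < d) (hn : 0 < n)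
    (D : Fin d → Type) [∀ i, Nonempty (D i)]
    (h f g : (i : Fin d) → D i → ℝ) (α : Fin d → ℝ)
    (hα : ∀ i, α i ∈ Set.Ioc (0 : ℝ) 1)
    (hpos : ∀ i x, 0 ≤ h i x)
    (hsum : ∀ i x, (α i * h i x) ^ 2 = f i x ^ 2 + g i x ^ 2)
    (t : Fin n → (i : Fin d) → D i) (a : Fin n → ℝ) :
    1 - (n : ℝ) * ∏ i, (1 + α i ^ 2)⁻¹ ≤
      sSup {y : ℝ | ∃ c : (Fin d → Fin 3) → ℝ, (∑ j, c j ^ 2) ≤ 1 ∧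
        y = (c (fun _ => 0) - ∑ k, a k * tensorFun h f g c (t k)) ^ 2} := by
  classical
  set b : (Fin d → Fin 3) → ((i : Fin d) → D i) → ℝ := fun j x =>
    ∏ i, (![h i, f i, g i] : Fin 3 → D i → ℝ) (j i) (x i) with hb
  set v : (Fin d → Fin 3) → ℝ := fun j =>
    (if j = fun _ => 0 then 1 else 0) - ∑ k, a k * b j (t k) with hv
  have hlin : ∀ c : (Fin d → Fin 3) → ℝ,
      c (fun _ => 0) - ∑ k, a k * tensorFun h f g c (t k) = ∑ j, c j * v j := by
    intro c
    simp only [hv, mul_sub, Finset.sum_sub_distrib, mul_ite, mul_one, mul_zero,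
      Finset.sum_ite_eq', Finset.mem_univ, if_true, tensorFun, Finset.mul_sum]
    rw [Finset.sum_comm]
    congr 1
    exact Finset.sum_congr rfl fun j _ => Finset.sum_congr rfl fun k _ => mul_left_comm _ _ _
  simp only [hlin]
  refine le_trans ?_ (sum_sq_le_sSup_sq_linear v)
  have hker : ∑ j, (∑ k, a k * b j (t k)) ^ 2 = ∑ k, ∑ l, a k * a l * ∏ i, ∑ m,
      (![h i, f i, g i] : Fin 3 → D i → ℝ) m (t k i) *
        (![h i, f i, g i] : Fin 3 → D i → ℝ) m (t l i) := by
    rw [sum_sq_linear_eq_gram_form]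
    simp only [hb, Fintype.prod_sum, Finset.prod_mul_distrib]
  have hnorm : ∑ j, v j ^ 2 = 1 - 2 * (∑ k, a k * ∏ i, h i (t k i)) +
      ∑ j, (∑ k, a k * b j (t k)) ^ 2 := by
    simp [hv, sub_sq, Finset.sum_add_distrib, Finset.sum_sub_distrib, ite_pow, mul_ite, ite_mul, hb]
  have hform := prod_mul_sq_le_kernel_form h f g α hα hpos hsum t a
  rw [← hker] at hform
  rw [hnorm, Finset.prod_inv_distrib]
  have hC : 0 < ∏ i, (1 + α i ^ 2) := Finset.prod_pos fun i _ => by positivity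
  have hn' : (0 : ℝ) < n := Nat.cast_pos.mpr hn
  generalize ∏ i, (1 + α i ^ 2) = C at *
  generalize ∑ k, a k * ∏ i, h i (t k i) = x at *
  generalize ∑ j, (∑ k, a k * b j (t k)) ^ 2 = Q at *
  have hQ : C * x ^ 2 / n ≤ Q := by
    rw [div_le_iff₀ hn']
    linarith
  have hsq : C * x ^ 2 / n - 2 * x + n * C⁻¹ = C / n * (x - n * C⁻¹) ^ 2 := by
    field_simp
    ring
  have : 0 ≤ C / n * (x - n * C⁻¹) ^ 2 := by positivity
  linarith
end

section
/- In the setting of the tensor-product lower bound, assume in addition that α_1 = ⋯ = α_d = α for some α ∈ (0,1]. If ε ∈ (0,1) and there exist n nodes t⁽¹⁾,…,t⁽ⁿ⁾ ∈ D_1 × ⋯ × D_d and weights a₁,…,aₙ ∈ ℝ such that sup{ | c_{(0,…,0)} − Σ_{k=1}^n a_k F_c(t⁽ᵏ⁾) | : Σ_j c_j² ≤ 1 } ≤ ε, then n ≥ (1 − ε²)(1 + α²)^d. In particular the curse of dimensionality holds for this family of tensor product problems. -/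
open Finset

/-- The quadratic form of a Gram matrix is a sum of squares. -/
theorem sum_mul_gram_eq_sum_sq {ι κ : Type*} [Fintype ι] [Fintype κ]
    (v : ι → κ → ℝ) (a : ι → ℝ) :
    ∑ k, ∑ l, a k * a l * ∑ j, v k j * v l j = ∑ j, (∑ k, a k * v k j) ^ 2 := by
  simp_rw [sq, sum_mul_sum, mul_sum]
  rw [sum_comm_cycle]
  refine sum_congr rfl fun _ _ => sum_congr rfl fun _ _ => sum_congr rfl fun _ _ => ?_
  ring

/-- **Vybíral's inequality**: the Hadamard square of a Gram matrix of `n` vectors dominates `1 / n`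
times the dyad of its diagonal. -/
theorem sq_sum_mul_diag_le_card_mul {ι κ : Type*} [Fintype ι] [Fintype κ]
    (v : ι → κ → ℝ) (a : ι → ℝ) :
    (∑ k, a k * ∑ j, v k j ^ 2) ^ 2 ≤
      Fintype.card ι * ∑ k, ∑ l, a k * a l * (∑ j, v k j * v l j) ^ 2 := by
  classical
  have hM := Matrix.posSemidef_self_mul_conjTranspose (Matrix.of v)
  obtain ⟨B, hB⟩ : ∃ B : Matrix ι ι ℝ, Matrix.of v * (Matrix.of v).conjTranspose =
      B.conjTranspose * B := by
    open scoped MatrixOrder in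
    exact CStarAlgebra.nonneg_iff_eq_star_mul_self.mp hM.nonneg
  have gram (k l : ι) : ∑ j, v k j * v l j = ∑ p, B p k * B p l := by
    simpa [Matrix.mul_apply] using congrFun (congrFun hB k) l
  -- Compare the trace and the Frobenius norm of `A = B diag(a) Bᵀ`.
  set A : ι → ι → ℝ := fun p q => ∑ k, a k * (B p k * B q k) with hA
  have trace_eq : ∑ k, a k * ∑ j, v k j ^ 2 = ∑ p, A p p := by
    simp_rw [sq, gram, hA, mul_sum]
    exact sum_comm
  have frob_eq : ∑ k, ∑ l, a k * a l * (∑ j, v k j * v l j) ^ 2 = ∑ p, ∑ q, A p q ^ 2 := by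
    have := sum_mul_gram_eq_sum_sq (fun k (x : ι × ι) => B x.1 k * B x.2 k) a
    rw [Fintype.sum_prod_type] at this
    rw [← this]
    simp_rw [gram, sq, sum_mul_sum, Fintype.sum_prod_type, mul_mul_mul_comm]
  rw [trace_eq, frob_eq]
  calc (∑ p, A p p) ^ 2 ≤ Fintype.card ι * ∑ p, A p p ^ 2 := sq_sum_le_card_mul_sum_sq
    _ ≤ _ := by
      gcongr with p
      exact single_le_sum (f := fun q => A p q ^ 2) (fun q _ => sq_nonneg _) (mem_univ p)

/-- A linear form bounded by `ε` on the Euclidean unit ball has Euclidean norm at most `ε`. -/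
theorem sum_sq_le_sq_of_forall_abs_le {J : Type*} [Fintype J] (r : J → ℝ) {ε : ℝ}
    (H : ∀ c : J → ℝ, ∑ j, c j ^ 2 ≤ 1 → |∑ j, c j * r j| ≤ ε) : ∑ j, r j ^ 2 ≤ ε ^ 2 := by
  set N := ∑ j, r j ^ 2 with hN
  have hN0 : 0 ≤ N := sum_nonneg fun j _ => sq_nonneg _
  rcases hN0.eq_or_lt with h0 | hpos
  · rw [← h0]; positivity
  have hs : 0 < √N := Real.sqrt_pos.2 hpos
  have hsq : √N ^ 2 = N := Real.sq_sqrt hN0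
  have key := H (fun j => r j / √N) (by
    simp_rw [div_pow, ← sum_div, hsq, ← hN, div_self hpos.ne', le_refl])
  have hsum : ∑ j, r j / √N * r j = √N := by
    simp_rw [div_mul_eq_mul_div, ← sq, ← sum_div, ← hN]
    rw [div_eq_iff hs.ne', ← sq, hsq]
  rw [hsum, abs_of_pos hs] at key
  rw [← hsq]
  gcongr

/-- A point of the plane, written in terms of its norm and a complex square root. -/
theorem exists_sq_add_sq_eq {h F G : ℝ} (hh : 0 ≤ h) (H : h ^ 2 = F ^ 2 + G ^ 2) :
    ∃ p q : ℝ, p ^ 2 + q ^ 2 = h ∧ p ^ 2 - q ^ 2 = F ∧ 2 * p * q = G := by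
  obtain ⟨w, hw⟩ := IsAlgClosed.exists_pow_nat_eq (⟨F, G⟩ : ℂ) two_pos
  have h1 : w.re ^ 2 - w.im ^ 2 = F := by
    simpa [sq] using congrArg Complex.re hw
  have h2 : 2 * w.re * w.im = G := by
    have := congrArg Complex.im hw
    simp only [sq, Complex.mul_im] at this
    linarith
  refine ⟨w.re, w.im, ?_, h1, h2⟩
  rw [← sq_eq_sq₀ (by positivity) hh, H, ← h1, ← h2]
  ring

/-- The reproducing kernel of a space spanned by `h, f, g` with `(α h)² = f² + g²` is a weighted
sum of two squares of Gram kernels with diagonal `h`. -/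
theorem exists_kernel_eq_sum_mul_sq {X : Type*} {h f g : X → ℝ} {α : ℝ} (hα : α ≠ 0)
    (hpos : ∀ x, 0 ≤ h x) (hsum : ∀ x, (α * h x) ^ 2 = f x ^ 2 + g x ^ 2) :
    ∃ u : Fin 2 → X → Fin 2 → ℝ, (∀ s x, ∑ j, u s x j ^ 2 = h x) ∧
      ∀ x y, h x * h y + f x * f y + g x * g y =
        ∑ s, (![1 - α ^ 2, 2 * α ^ 2] : Fin 2 → ℝ) s * (∑ j, u s x j * u s y j) ^ 2 := by
  have hroot (x : X) := exists_sq_add_sq_eq (F := f x / α) (G := g x / α) (hpos x) (by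
    rw [div_pow, div_pow, ← add_div, ← hsum x]
    field_simp)
  choose p q hpq hF hG using hroot
  refine ⟨![fun x => ![√(h x), 0], fun x => ![p x, q x]], fun s x => ?_, fun x y => ?_⟩
  · fin_cases s <;> simp [hpos x, hpq]
  · have hf (z : X) : f z = α * (p z ^ 2 - q z ^ 2) := by rw [hF]; field_simp
    have hg (z : X) : g z = α * (2 * p z * q z) := by rw [hG]; field_simp
    simp only [Fin.sum_univ_two, Matrix.cons_val_zero, Matrix.cons_val_one, mul_zero, add_zero,
      mul_pow, Real.sq_sqrt (hpos _), hf, hg]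
    rw [← hpq x, ← hpq y]
    ring

/-- The tensor product kernel dominates `(1 + α²) ^ d / n` times the dyad of the product of
the `h i`. -/
theorem pow_mul_sq_sum_le_card_mul_kernel {d : ℕ} {κ : Type*} [Fintype κ] {D : Fin d → Type*}
    {h f g : (i : Fin d) → D i → ℝ} {α : ℝ} (hα : α ∈ Set.Ioc (0 : ℝ) 1)
    (hpos : ∀ i x, 0 ≤ h i x)
    (hsum : ∀ i x, (α * h i x) ^ 2 = f i x ^ 2 + g i x ^ 2)
    (t : κ → (i : Fin d) → D i) (a : κ → ℝ) :
    (1 + α ^ 2) ^ d * (∑ k, a k * ∏ i, h i (t k i)) ^ 2 ≤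
      Fintype.card κ * ∑ k, ∑ l, a k * a l * ∏ i, (h i (t k i) * h i (t l i) +
        f i (t k i) * f i (t l i) + g i (t k i) * g i (t l i)) := by
  choose u hu hK using fun i => exists_kernel_eq_sum_mul_sq hα.1.ne' (hpos i) (hsum i)
  set w : Fin 2 → ℝ := ![1 - α ^ 2, 2 * α ^ 2] with hw
  have hw0 (s : Fin 2) : 0 ≤ w s := by
    have : α ^ 2 ≤ 1 := pow_le_one₀ hα.1.le hα.2
    fin_cases s
    · simpa [hw] using this
    · simp only [hw, Fin.mk_one, Matrix.cons_val_one, Matrix.cons_val_fin_one]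
      positivity
  have hwsum : (1 + α ^ 2) ^ d = ∑ σ : Fin d → Fin 2, ∏ i, w (σ i) := by
    rw [← Fintype.prod_sum fun (_ : Fin d) s => w s]
    simp only [hw, Fin.sum_univ_two, Matrix.cons_val_zero, Matrix.cons_val_one, prod_const,
      card_univ, Fintype.card_fin]
    ring
  let v (σ : Fin d → Fin 2) (k : κ) (j : Fin d → Fin 2) : ℝ := ∏ i, u i (σ i) (t k i) (j i)
  have hdiag (σ : Fin d → Fin 2) (k : κ) : ∑ j, v σ k j ^ 2 = ∏ i, h i (t k i) := by
    simp_rw [v, ← prod_pow]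
    rw [← Fintype.prod_sum fun i s => u i (σ i) (t k i) s ^ 2]
    exact prod_congr rfl fun i _ => hu i (σ i) (t k i)
  have hgram (σ : Fin d → Fin 2) (k l : κ) : ∑ j, v σ k j * v σ l j =
      ∏ i, ∑ j, u i (σ i) (t k i) j * u i (σ i) (t l i) j := by
    simp_rw [v, ← prod_mul_distrib]
    rw [Fintype.prod_sum]
  have hker (k l : κ) : ∏ i, (h i (t k i) * h i (t l i) +
        f i (t k i) * f i (t l i) + g i (t k i) * g i (t l i)) =
      ∑ σ : Fin d → Fin 2, (∏ i, w (σ i)) * (∑ j, v σ k j * v σ l j) ^ 2 := by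
    simp_rw [hK, hgram, ← prod_pow, ← prod_mul_distrib]
    rw [Fintype.prod_sum]
  have hrhs : ∑ k, ∑ l, a k * a l * ∏ i, (h i (t k i) * h i (t l i) +
        f i (t k i) * f i (t l i) + g i (t k i) * g i (t l i)) =
      ∑ σ : Fin d → Fin 2, (∏ i, w (σ i)) *
        ∑ k, ∑ l, a k * a l * (∑ j, v σ k j * v σ l j) ^ 2 := by
    simp_rw [hker, mul_sum]
    rw [sum_comm_cycle]
    refine sum_congr rfl fun _ _ => sum_congr rfl fun _ _ => sum_congr rfl fun _ _ => ?_
    ring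
  rw [hrhs, hwsum, sum_mul, mul_sum]
  refine sum_le_sum fun σ _ => ?_
  have key := sq_sum_mul_diag_le_card_mul (v σ) a
  simp_rw [hdiag] at key
  calc _ ≤ _ := mul_le_mul_of_nonneg_left key (prod_nonneg fun i _ => hw0 (σ i))
    _ = _ := by ring

/-- In the tensor product setting with equal `α_i = α`, if an `n`-point quadrature has worst
case error at most `ε ∈ (0,1)` over the coefficient unit ball, then
`n ≥ (1-ε²)(1+α²)^d`. -/
theorem tensor_product_curse (d n : ℕ) (hd : 0 < d) (hn : 0 < n)
    (D : Fin d → Type) [∀ i, Nonempty (D i)]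
    (h f g : (i : Fin d) → D i → ℝ) (α : ℝ)
    (hα : α ∈ Set.Ioc (0 : ℝ) 1)
    (hpos : ∀ i x, 0 ≤ h i x)
    (hsum : ∀ i x, (α * h i x) ^ 2 = f i x ^ 2 + g i x ^ 2)
    (ε : ℝ) (hε : ε ∈ Set.Ioo (0 : ℝ) 1)
    (t : Fin n → (i : Fin d) → D i) (a : Fin n → ℝ)
    (herr : ∀ c : (Fin d → Fin 3) → ℝ, (∑ j, c j ^ 2) ≤ 1 →
      |c (fun _ => 0) - ∑ k, a k * tensorFun h f g c (t k)| ≤ ε) :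
    (1 - ε ^ 2) * (1 + α ^ 2) ^ d ≤ (n : ℝ) := by
  classical
  let b (k : Fin n) (j : Fin d → Fin 3) : ℝ :=
    ∏ i, (![h i, f i, g i] : Fin 3 → D i → ℝ) (j i) (t k i)
  let e (j : Fin d → Fin 3) : ℝ := if j = fun _ => 0 then 1 else 0
  have hr := sum_sq_le_sq_of_forall_abs_le (fun j => e j - ∑ k, a k * b k j) (ε := ε) (by
    intro c hc
    convert herr c hc using 2
    simp only [mul_sub, sum_sub_distrib, tensorFun, mul_sum]
    congr 1
    · simp [e]
    · rw [sum_comm]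
      refine sum_congr rfl fun _ _ => sum_congr rfl fun _ _ => ?_
      simp only [b]
      ring)
  have hb0 (k : Fin n) : b k (fun _ => 0) = ∏ i, h i (t k i) := by simp [b]
  have hkernel (k l : Fin n) : ∑ j, b k j * b l j = ∏ i, (h i (t k i) * h i (t l i) +
      f i (t k i) * f i (t l i) + g i (t k i) * g i (t l i)) := by
    simp_rw [b, ← prod_mul_distrib]
    rw [← Fintype.prod_sum fun i s => (![h i, f i, g i] : Fin 3 → D i → ℝ) s (t k i) *
      (![h i, f i, g i] : Fin 3 → D i → ℝ) s (t l i)]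
    simp [Fin.sum_univ_three]
  have hexpand : ∑ j, (e j - ∑ k, a k * b k j) ^ 2 =
      1 - 2 * ∑ k, a k * b k (fun _ => 0) + ∑ k, ∑ l, a k * a l * ∑ j, b k j * b l j := by
    rw [sum_mul_gram_eq_sum_sq]
    simp_rw [sub_sq, sum_add_distrib, sum_sub_distrib, mul_assoc, ← mul_sum]
    simp [e]
  rw [hexpand] at hr
  simp_rw [hkernel, hb0] at hr
  have key := pow_mul_sq_sum_le_card_mul_kernel hα hpos hsum t a
  rw [Fintype.card_fin] at key
  set s := ∑ k, a k * ∏ i, h i (t k i)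
  set Q := ∑ k, ∑ l, a k * a l * ∏ i, (h i (t k i) * h i (t l i) +
      f i (t k i) * f i (t l i) + g i (t k i) * g i (t l i))
  set C := (1 + α ^ 2) ^ d
  have hC : 0 < C := by positivity
  have hn' : (0 : ℝ) < n := by exact_mod_cast hn
  have h1 : n * (1 - ε ^ 2) ≤ 2 * n * s - C * s ^ 2 := by
    have := mul_le_mul_of_nonneg_left hr hn'.le
    linarith
  have h2 := mul_le_mul_of_nonneg_left h1 hC.le
  have h3 : n * ((1 - ε ^ 2) * C) ≤ n * n := by
    linarith [sq_nonneg (n - C * s)]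
  exact le_of_mul_le_mul_left h3 hn'
end
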